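/- Suppose p > p_S. There exists a strictly increasing sequence 0 < λ₁* < λ₂* < ··· with λ_n* → ∞ such that for each n ≥ 1 there is a function U_n* ∈ C²((0,1)) ∩ C⁰((0,1]) satisfying: (i) (U_n*)''(r) + ((N−1)/r)(U_n*)'(r) + λ_n* f(U_n*(r)) = 0 for all r ∈ (0,1) and (U_n*)'(1) = 0; (ii) U_n*(r) = A (√(λ_n*) r)^{−θ}(1 + o(1)) as r ↓ 0, i.e. r^θ U_n*(r) → A (λ_n*)^{−θ/2}; (iii) U_n*(r) − 1 has exactly n zeros in (0,1]; (iv) U_n*(r) > 0 for all r ∈ (0,1]; (v) ∫₀^1 (U_n*(r)² + ((U_n*)'(r))²) r^{N−1} dr < ∞. Moreover the pair (λ_n*, U_n*) is the unique pair (λ̃, Ũ) with λ̃ > 0 and Ũ ∈ C²((0,1)) ∩ C⁰((0,1]) satisfying (i), (ii) (with λ̃ in place of λ_n*), (iii) and (iv). -/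

import Mathlib

open Real Set Filter Topology MeasureTheory

noncomputable section

/-- The nonlinearity `f(u) = -u + u^p`. -/
def fNL (p u : ℝ) : ℝ := -u + u ^ p

/-- The Sobolev critical exponent `p_S = (N+2)/(N-2)`. -/
def pSob (N : ℕ) : ℝ := ((N : ℝ) + 2) / ((N : ℝ) - 2)

/-- `θ = 2/(p-1)`. -/
def thetaP (p : ℝ) : ℝ := 2 / (p - 1)

/-- `A = (θ(N-2-θ))^{1/(p-1)}`. -/
def Aconst (N : ℕ) (p : ℝ) : ℝ :=
  (thetaP p * ((N : ℝ) - 2 - thetaP p)) ^ (1 / (p - 1))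

/-- `m = (θ(N-2-θ))^{-1/2}`. -/
def mConst (N : ℕ) (p : ℝ) : ℝ :=
  (thetaP p * ((N : ℝ) - 2 - thetaP p)) ^ (-(1 / 2) : ℝ)

/-- `α = m(N-2-2θ)`. -/
def alphaConst (N : ℕ) (p : ℝ) : ℝ :=
  mConst N p * ((N : ℝ) - 2 - 2 * thetaP p)

/-- The condition `p < p_JL`, where `p_JL = 1 + 4/(N-4-2√(N-1))` for `N ≥ 11` and
`p_JL = ∞` for `N ≤ 10`. -/
def pJLcond (N : ℕ) (p : ℝ) : Prop :=
  11 ≤ N → p < 1 + 4 / ((N : ℝ) - 4 - 2 * Real.sqrt ((N : ℝ) - 1))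

/-- `y` is a C² solution of `y'' + α y' - y + y^p - m² e^{2mt} y = 0` on `(-∞, T]`
with `y → 1` as `t → -∞`; `y'`, `y''` are its first and second derivatives. -/
def IsSingODEOn (N : ℕ) (p T : ℝ) (y y' y'' : ℝ → ℝ) : Prop :=
  (∀ t ∈ Iic T, HasDerivWithinAt y (y' t) (Iic T) t) ∧
  (∀ t ∈ Iic T, HasDerivWithinAt y' (y'' t) (Iic T) t) ∧
  ContinuousOn y'' (Iic T) ∧
  (∀ t ∈ Iic T, y'' t + alphaConst N p * y' t - y t + y t ^ p
      - (mConst N p) ^ 2 * Real.exp (2 * mConst N p * t) * y t = 0) ∧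
  Tendsto y atBot (𝓝 1)

/-- `y` is a C² solution of `y'' + α y' - y + y^p - m² e^{2mt} y = 0` on all of `ℝ`
with `y → 1` as `t → -∞`. -/
def IsEntireSingODE (N : ℕ) (p : ℝ) (y y' y'' : ℝ → ℝ) : Prop :=
  (∀ t : ℝ, HasDerivAt y (y' t) t) ∧
  (∀ t : ℝ, HasDerivAt y' (y'' t) t) ∧
  Continuous y'' ∧
  (∀ t : ℝ, y'' t + alphaConst N p * y' t - y t + y t ^ p
      - (mConst N p) ^ 2 * Real.exp (2 * mConst N p * t) * y t = 0) ∧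
  Tendsto y atBot (𝓝 1)

/-- The singular solution `u*(s) = A s^{-θ} y*(m⁻¹ log s)` built from `y*`. -/
def ustar (N : ℕ) (p : ℝ) (y : ℝ → ℝ) (s : ℝ) : ℝ :=
  Aconst N p * s ^ (-(thetaP p)) * y (Real.log s / mConst N p)

/-- `u` is a C² solution on `[0,∞)` of the IVP `u'' + ((N-1)/s)u' + f(u) = 0`,
`u(0) = γ`, `u'(0) = 0`, with nonlinearity `f(u) = -u + u^p`. -/
def IsIVPSol (N : ℕ) (p γ : ℝ) (u u' u'' : ℝ → ℝ) : Prop :=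
  (∀ s ∈ Ici (0:ℝ), HasDerivWithinAt u (u' s) (Ici 0) s) ∧
  (∀ s ∈ Ici (0:ℝ), HasDerivWithinAt u' (u'' s) (Ici 0) s) ∧
  ContinuousOn u'' (Ici 0) ∧
  u 0 = γ ∧ u' 0 = 0 ∧
  (∀ s > (0:ℝ), u'' s + ((N : ℝ) - 1) / s * u' s + fNL p (u s) = 0)

/-- `u` is a C² solution on `[0,∞)` of the IVP `u'' + ((N-1)/ρ)u' + u^p = 0`,
`u(0) = γ`, `u'(0) = 0`. -/
def IsBarSol (N : ℕ) (p γ : ℝ) (u u' u'' : ℝ → ℝ) : Prop :=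
  (∀ ρ ∈ Ici (0:ℝ), HasDerivWithinAt u (u' ρ) (Ici 0) ρ) ∧
  (∀ ρ ∈ Ici (0:ℝ), HasDerivWithinAt u' (u'' ρ) (Ici 0) ρ) ∧
  ContinuousOn u'' (Ici 0) ∧
  u 0 = γ ∧ u' 0 = 0 ∧
  (∀ ρ > (0:ℝ), u'' ρ + ((N : ℝ) - 1) / ρ * u' ρ + u ρ ^ p = 0)

/-- `s` is the `(k+1)`-th positive critical point of a function whose derivative is `u'`:
`s` is a positive critical point having exactly `k` positive critical points below it. -/
def IsNthCritPt (u' : ℝ → ℝ) (k : ℕ) (s : ℝ) : Prop :=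
  0 < s ∧ u' s = 0 ∧ {x : ℝ | 0 < x ∧ x < s ∧ u' x = 0}.encard = (k : ℕ∞)

/-- `U` is a positive C² radial solution of the Neumann problem
`U'' + ((N-1)/r)U' + λ f(U) = 0` on `(0,1)`, `U'(0) = U'(1) = 0`, `U > 0` on `[0,1]`. -/
def NeumannSol (N : ℕ) (p lam : ℝ) (U U' U'' : ℝ → ℝ) : Prop :=
  (∀ r ∈ Icc (0:ℝ) 1, HasDerivWithinAt U (U' r) (Icc 0 1) r) ∧
  (∀ r ∈ Icc (0:ℝ) 1, HasDerivWithinAt U' (U'' r) (Icc 0 1) r) ∧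
  ContinuousOn U'' (Icc 0 1) ∧
  (∀ r ∈ Ioo (0:ℝ) 1, U'' r + ((N : ℝ) - 1) / r * U' r + lam * fNL p (U r) = 0) ∧
  U' 0 = 0 ∧ U' 1 = 0 ∧ (∀ r ∈ Icc (0:ℝ) 1, 0 < U r)

/-- `(lam, U)` is a singular solution of the Neumann problem whose graph meets `1`
exactly `n` times: `U` is C² on `(0,1)`, continuous on `(0,1]`, `U'(1) = 0`, it solves
`U'' + ((N-1)/r)U' + λ f(U) = 0` on `(0,1)`, satisfies the asymptotics
`U(r) = A(√λ r)^{-θ}(1+o(1))` as `r ↓ 0` (i.e. `r^θ U(r) → A λ^{-θ/2}`),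
`U - 1` has exactly `n` zeros in `(0,1]`, and `U > 0` on `(0,1]`. -/
def SingBVPSol (N : ℕ) (p lam : ℝ) (n : ℕ) (U U' U'' : ℝ → ℝ) : Prop :=
  (∀ r ∈ Ioc (0:ℝ) 1, HasDerivWithinAt U (U' r) (Ioc 0 1) r) ∧
  (∀ r ∈ Ioo (0:ℝ) 1, HasDerivAt U' (U'' r) r) ∧
  ContinuousOn U (Ioc 0 1) ∧
  ContinuousOn U'' (Ioo 0 1) ∧
  (∀ r ∈ Ioo (0:ℝ) 1, U'' r + ((N : ℝ) - 1) / r * U' r + lam * fNL p (U r) = 0) ∧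
  U' 1 = 0 ∧
  Tendsto (fun r => r ^ thetaP p * U r) (𝓝[>] (0:ℝ))
    (𝓝 (Aconst N p * lam ^ (-(thetaP p) / 2))) ∧
  {r ∈ Ioc (0:ℝ) 1 | U r = 1}.encard = (n : ℕ∞) ∧
  (∀ r ∈ Ioc (0:ℝ) 1, 0 < U r)

/-! ### Global solutions of Lipschitz differential equations -/

/-- Truncation of both coordinates to `[-R, R]`. -/
def boxTrunc (R : ℝ) (x : ℝ × ℝ) : ℝ × ℝ :=
  (max (-R) (min R x.1), max (-R) (min R x.2))

lemma boxTrunc_lipschitz (R : ℝ) : LipschitzWith 1 (boxTrunc R) := by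
  have h1 : LipschitzWith 1 fun x : ℝ × ℝ => max (-R) (min R x.1) :=
    (LipschitzWith.prod_fst.const_min R).const_max (-R)
  have h2 : LipschitzWith 1 fun x : ℝ × ℝ => max (-R) (min R x.2) :=
    (LipschitzWith.prod_snd.const_min R).const_max (-R)
  have h := h1.prodMk h2
  rw [max_self] at h
  exact h

lemma abs_clamp_le {R : ℝ} (hR : 0 ≤ R) (y : ℝ) :
    |max (-R) (min R y)| ≤ R ∧ |max (-R) (min R y)| ≤ |y| := by
  rcases abs_cases y with h | h <;> constructor <;> rw [abs_le] <;>
    constructor <;> grind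

lemma norm_boxTrunc_le {R : ℝ} (hR : 0 ≤ R) (x : ℝ × ℝ) :
    ‖boxTrunc R x‖ ≤ R ∧ ‖boxTrunc R x‖ ≤ ‖x‖ := by
  obtain ⟨a, b⟩ := abs_clamp_le hR x.1
  obtain ⟨c, d⟩ := abs_clamp_le hR x.2
  simp only [Prod.norm_def, boxTrunc, Real.norm_eq_abs]
  exact ⟨max_le a c, max_le_max b d⟩

lemma boxTrunc_eq {R : ℝ} {x : ℝ × ℝ} (hx : ‖x‖ ≤ R) : boxTrunc R x = x := by
  simp only [Prod.norm_def, Real.norm_eq_abs] at hx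
  have h1 := abs_le.1 ((le_max_left _ _).trans hx)
  have h2 := abs_le.1 ((le_max_right _ _).trans hx)
  ext
  · simp [boxTrunc, h1.1, h1.2]
  · simp [boxTrunc, h2.1, h2.2]

lemma norm_le_gronwall_forward {E : Type*} [NormedAddCommGroup E] [NormedSpace ℝ E]
    {F : ℝ → E → E} {X : ℝ → E} {t₀ L K B : ℝ} (hK : 0 ≤ K) (hB : 0 ≤ B)
    (hX : ∀ t ∈ Icc t₀ (t₀ + L), HasDerivWithinAt X (F t (X t)) (Icc t₀ (t₀ + L)) t)
    (hF : ∀ t ∈ Icc t₀ (t₀ + L), ∀ x, ‖F t x‖ ≤ K * ‖x‖ + B) :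
    ∀ t ∈ Icc t₀ (t₀ + L), ‖X t‖ ≤ gronwallBound ‖X t₀‖ K B L := by
  intro t ht
  have h := norm_le_gronwallBound_of_norm_deriv_right_le
    (f := X) (f' := fun t => F t (X t)) (δ := ‖X t₀‖) (K := K) (ε := B) (a := t₀) (b := t₀ + L)
    (fun t ht => (hX t ht).continuousWithinAt)
    (fun t ht => (hX t ⟨ht.1, ht.2.le⟩).mono_of_mem_nhdsWithin (Icc_mem_nhdsGE_of_mem ht))
    le_rfl (fun t ht => hF t ⟨ht.1, ht.2.le⟩ _) t ht
  exact h.trans (gronwallBound_mono (norm_nonneg _) hB hK (by linarith [ht.2]))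

lemma norm_le_gronwall_two_sided {E : Type*} [NormedAddCommGroup E] [NormedSpace ℝ E]
    {F : ℝ → E → E} {X : ℝ → E} {t₀ L K B : ℝ} (hL : 0 ≤ L) (hK : 0 ≤ K) (hB : 0 ≤ B)
    (hX : ∀ t ∈ Icc (t₀ - L) (t₀ + L),
      HasDerivWithinAt X (F t (X t)) (Icc (t₀ - L) (t₀ + L)) t)
    (hF : ∀ t ∈ Icc (t₀ - L) (t₀ + L), ∀ x, ‖F t x‖ ≤ K * ‖x‖ + B) :
    ∀ t ∈ Icc (t₀ - L) (t₀ + L), ‖X t‖ ≤ gronwallBound ‖X t₀‖ K B L := by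
  intro t ht
  rcases le_total t₀ t with h | h
  · exact norm_le_gronwall_forward hK hB
      (fun s hs => (hX s ⟨by linarith [hs.1], hs.2⟩).mono (Icc_subset_Icc (by linarith) le_rfl))
      (fun s hs => hF s ⟨by linarith [hs.1], hs.2⟩) t ⟨h, ht.2⟩
  · have key := norm_le_gronwall_forward (F := fun s x => -F (-s) x) (X := fun s => X (-s))
      (t₀ := -t₀) (L := L) hK hB (fun s hs => by
        have h1 : -s ∈ Icc (t₀ - L) (t₀ + L) := ⟨by linarith [hs.2], by linarith [hs.1]⟩
        have h2 := (hX (-s) h1).scomp (s := Icc (-t₀) (-t₀ + L)) s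
          (hasDerivAt_neg s).hasDerivWithinAt
          (fun r hr => ⟨by linarith [hr.2], by linarith [hr.1]⟩)
        rw [neg_one_smul] at h2
        exact h2)
      (fun s hs x => by
        rw [norm_neg]
        exact hF (-s) ⟨by linarith [hs.2], by linarith [hs.1]⟩ x) (-t)
      ⟨by linarith, by linarith [ht.1]⟩
    simpa using key

lemma exists_solution_Icc {F : ℝ → ℝ × ℝ → ℝ × ℝ} {K : NNReal}
    (hF : ∀ t, LipschitzWith K (F t)) (hc : ∀ x, Continuous fun t => F t x)
    (t₀ : ℝ) (x₀ : ℝ × ℝ) {L : ℝ} (hL : 0 ≤ L) :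
    ∃ X : ℝ → ℝ × ℝ, X t₀ = x₀ ∧ ∀ t ∈ Icc (t₀ - L) (t₀ + L),
      HasDerivWithinAt X (F t (X t)) (Icc (t₀ - L) (t₀ + L)) t := by
  obtain ⟨B, hB⟩ := (isCompact_Icc (a := t₀ - L) (b := t₀ + L)).exists_bound_of_continuousOn
    (hc 0).continuousOn
  have ht₀ : t₀ ∈ Icc (t₀ - L) (t₀ + L) := ⟨by linarith, by linarith⟩
  have hB0 : 0 ≤ B := (norm_nonneg _).trans (hB t₀ ht₀)
  have hFb : ∀ t ∈ Icc (t₀ - L) (t₀ + L), ∀ x, ‖F t x‖ ≤ K * ‖x‖ + B := by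
    intro t ht x
    have h1 := (hF t).dist_le_mul x 0
    rw [dist_eq_norm, dist_zero_right] at h1
    have h2 : ‖F t x‖ ≤ ‖F t x - F t 0‖ + ‖F t 0‖ := by
      simpa using norm_add_le (F t x - F t 0) (F t 0)
    linarith [hB t ht]
  set R := gronwallBound ‖x₀‖ K B L with hRdef
  have hR : 0 ≤ R := by
    have := gronwallBound_mono (norm_nonneg x₀) hB0 K.2 hL
    simp only [gronwallBound_x0] at this
    exact (norm_nonneg _).trans this
  set G : ℝ → ℝ × ℝ → ℝ × ℝ := fun t x => F t (boxTrunc R x) with hG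
  have hGK : ∀ t, LipschitzWith K (G t) := fun t => by
    have h := (hF t).comp (boxTrunc_lipschitz R)
    rw [mul_one] at h
    exact h
  have hpl : IsPicardLindelof G (tmin := t₀ - L) (tmax := t₀ + L) ⟨t₀, ht₀⟩ x₀
      (Real.toNNReal ((K * R + B) * L)) 0 (Real.toNNReal (K * R + B)) K := by
    refine ⟨fun t _ => (hGK t).lipschitzOnWith, fun x _ => (hc _).continuousOn, ?_, ?_⟩
    · intro t ht x _
      rw [Real.coe_toNNReal _ (by positivity)]
      have h1 := hFb t ht (boxTrunc R x)
      have h2 := mul_le_mul_of_nonneg_left (norm_boxTrunc_le hR x).1 K.2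
      have h3 : (K : ℝ) * ‖boxTrunc R x‖ ≤ K * R := h2
      linarith
    · rw [Real.coe_toNNReal _ (by positivity), Real.coe_toNNReal _ (by positivity)]
      simp
  obtain ⟨X, hX0, hX⟩ := hpl.exists_eq_forall_mem_Icc_hasDerivWithinAt₀
  have hX0 : X t₀ = x₀ := hX0
  have hbd := norm_le_gronwall_two_sided hL K.2 hB0 hX (fun t ht x => by
    have h1 := hFb t ht (boxTrunc R x)
    have h2 := mul_le_mul_of_nonneg_left (norm_boxTrunc_le hR x).2 K.2
    exact h1.trans (by simpa using h2))
  refine ⟨X, hX0, fun t ht => ?_⟩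
  have h1 := hX t ht
  have h2 : ‖X t‖ ≤ R := by
    have := hbd t ht
    rw [hX0] at this
    exact this
  simpa only [hG, boxTrunc_eq h2] using h1

/-- Functions that agree on `(-n, n)` glue to a single function. -/
lemma exists_glue {E : Type*} (f : ℕ → ℝ → E)
    (h : ∀ n m : ℕ, n ≤ m → ∀ t : ℝ, |t| < n → f m t = f n t) :
    ∃ g : ℝ → E, ∀ (n : ℕ) (t : ℝ), |t| < n → g t = f n t := by
  refine ⟨fun t => f (⌊|t|⌋₊ + 1) t, fun n t ht => ?_⟩
  have h1 : |t| < ((⌊|t|⌋₊ + 1 : ℕ) : ℝ) := by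
    push_cast
    exact Nat.lt_floor_add_one _
  have h2 : ⌊|t|⌋₊ + 1 ≤ n := by
    have := (Nat.floor_lt (abs_nonneg t)).2 ht
    omega
  exact (h _ _ h2 t h1).symm

lemma eventually_abs_lt {n : ℕ} {t : ℝ} (ht : |t| < n) : ∀ᶠ s : ℝ in 𝓝 t, |s| < n :=
  (continuous_abs.tendsto t).eventually_lt_const ht

lemma exists_global_solution {F : ℝ → ℝ × ℝ → ℝ × ℝ} {K : NNReal}
    (hF : ∀ t, LipschitzWith K (F t)) (hc : ∀ x, Continuous fun t => F t x)
    (t₀ : ℝ) (x₀ : ℝ × ℝ) :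
    ∃ X : ℝ → ℝ × ℝ, X t₀ = x₀ ∧ ∀ t, HasDerivAt X (F t (X t)) t := by
  choose f hf0 hf using fun n : ℕ =>
    exists_solution_Icc hF hc t₀ x₀ (L := |t₀| + n) (by positivity)
  have hsub : ∀ (n : ℕ) (t : ℝ), |t| < n →
      t ∈ Ioo (t₀ - (|t₀| + n)) (t₀ + (|t₀| + n)) := by
    intro n t ht
    have h1 := abs_lt.1 ht
    have h2 := abs_le.1 (le_refl |t₀|)
    exact ⟨by linarith [h1.1, h2.2], by linarith [h1.2, h2.1]⟩
  have hd : ∀ (n : ℕ), ∀ t ∈ Ioo (t₀ - (|t₀| + n)) (t₀ + (|t₀| + n)),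
      HasDerivAt (f n) (F t (f n t)) t := fun n t ht =>
    (hf n t (Ioo_subset_Icc_self ht)).hasDerivAt (Icc_mem_nhds ht.1 ht.2)
  obtain ⟨g, hg⟩ := exists_glue f (fun n m hnm t ht => by
    have hnm' : (n : ℝ) ≤ m := by exact_mod_cast hnm
    have hn : 0 < (n : ℝ) := (abs_nonneg t).trans_lt ht
    refine ODE_solution_unique_of_mem_Ioo (v := F) (s := fun _ => univ) (K := K)
      (t₀ := t₀) (a := t₀ - (|t₀| + n)) (b := t₀ + (|t₀| + n)) (fun t _ => (hF t).lipschitzOnWith)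
      ⟨by linarith [abs_nonneg t₀], by linarith [abs_nonneg t₀]⟩
      (fun s hs => ⟨hd m s ⟨by linarith [hs.1], by linarith [hs.2]⟩, trivial⟩)
      (fun s hs => ⟨hd n s hs, trivial⟩) (by rw [hf0, hf0]) (hsub n t ht))
  have key : ∀ t : ℝ, ∃ n : ℕ, |t| < n := fun t => exists_nat_gt _
  refine ⟨g, ?_, fun t => ?_⟩
  · obtain ⟨n, hn⟩ := key t₀
    rw [hg n t₀ hn, hf0]
  · obtain ⟨n, hn⟩ := key t
    rw [hg n t hn]
    exact (hd n t (hsub n t hn)).congr_of_eventuallyEq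
      ((eventually_abs_lt hn).mono fun s hs => hg n s hs)

lemma dist_le_backward {F : ℝ → ℝ × ℝ → ℝ × ℝ} {K : NNReal}
    (hF : ∀ t, LipschitzWith K (F t)) {X Y : ℝ → ℝ × ℝ}
    (hX : ∀ t, HasDerivAt X (F t (X t)) t) (hY : ∀ t, HasDerivAt Y (F t (Y t)) t)
    {t T : ℝ} (ht : t ≤ T) :
    dist (X t) (Y t) ≤ dist (X T) (Y T) * exp (K * (T - t)) := by
  have hrev : ∀ Z : ℝ → ℝ × ℝ, (∀ t, HasDerivAt Z (F t (Z t)) t) →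
      ∀ s, HasDerivAt (fun s => Z (-s)) (-F (-s) (Z (-s))) s := fun Z hZ s => by
    have h := (hZ (-s)).scomp s (hasDerivAt_neg s)
    rw [neg_one_smul] at h
    exact h
  have h := dist_le_of_trajectories_ODE (v := fun s x => -F (-s) x) (K := K)
    (f := fun s => X (-s)) (g := fun s => Y (-s)) (a := -T) (b := -t)
    (δ := dist (X T) (Y T)) (fun s => (hF (-s)).neg)
    (fun s _ => (hrev X hX s).continuousAt.continuousWithinAt)
    (fun s _ => (hrev X hX s).hasDerivWithinAt)
    (fun s _ => (hrev Y hY s).continuousAt.continuousWithinAt)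
    (fun s _ => (hrev Y hY s).hasDerivWithinAt) (by simp) (-t) ⟨by linarith, le_rfl⟩
  simpa [sub_eq_add_neg, add_comm] using h

/-! ### Second order equations: uniqueness -/

lemma antitoneOn_of_hasDerivAt_nonpos {D : Set ℝ} (hD : Convex ℝ D) {f f' : ℝ → ℝ}
    (hf : ∀ t ∈ D, HasDerivAt f (f' t) t) (hf' : ∀ t ∈ D, f' t ≤ 0) : AntitoneOn f D :=
  antitoneOn_of_hasDerivWithinAt_nonpos hD
    (fun t ht => (hf t ht).continuousAt.continuousWithinAt)
    (fun t ht => (hf t (interior_subset ht)).hasDerivWithinAt)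
    (fun t ht => hf' t (interior_subset ht))

lemma monotoneOn_of_hasDerivAt_nonneg {D : Set ℝ} (hD : Convex ℝ D) {f f' : ℝ → ℝ}
    (hf : ∀ t ∈ D, HasDerivAt f (f' t) t) (hf' : ∀ t ∈ D, 0 ≤ f' t) : MonotoneOn f D :=
  monotoneOn_of_hasDerivWithinAt_nonneg hD
    (fun t ht => (hf t ht).continuousAt.continuousWithinAt)
    (fun t ht => (hf t (interior_subset ht)).hasDerivWithinAt)
    (fun t ht => hf' t (interior_subset ht))

lemma second_order_eq_zero {a K α β t₀ : ℝ} {w v q : ℝ → ℝ} (ha : 0 ≤ a) (hK : 0 ≤ K)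
    (hw : ∀ t ∈ Icc α β, HasDerivAt w (v t) t)
    (hv : ∀ t ∈ Icc α β, HasDerivAt v (-a * v t - q t) t)
    (hq : ∀ t ∈ Icc α β, |q t| ≤ K * |w t|)
    (ht₀ : t₀ ∈ Icc α β) (hw0 : w t₀ = 0) (hv0 : v t₀ = 0) :
    ∀ t ∈ Icc α β, w t = 0 := by
  set C := 1 + K + 2 * a with hC
  have hder : ∀ (c : ℝ), ∀ t ∈ Icc α β, HasDerivAt (fun t => (w t ^ 2 + v t ^ 2) * exp (c * t))
      ((2 * w t * v t + 2 * v t * (-a * v t - q t) + c * (w t ^ 2 + v t ^ 2)) * exp (c * t)) t := by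
    intro c t ht
    have h1 := ((hw t ht).pow 2).add ((hv t ht).pow 2)
    have h2 : HasDerivAt (fun t : ℝ => exp (c * t)) (exp (c * t) * c) t := by
      simpa using ((hasDerivAt_id t).const_mul c).exp
    refine (h1.mul h2).congr_deriv ?_
    simp only [Pi.add_apply, Pi.pow_apply]
    push_cast
    ring
  have hbound : ∀ t ∈ Icc α β,
      |2 * w t * v t + 2 * v t * (-a * v t - q t)| ≤ C * (w t ^ 2 + v t ^ 2) := by
    intro t ht
    have h1 : |v t * q t| ≤ K * (|v t| * |w t|) := by
      rw [abs_mul]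
      nlinarith [hq t ht, abs_nonneg (v t)]
    have h2 : 2 * (|v t| * |w t|) ≤ w t ^ 2 + v t ^ 2 := by
      nlinarith [sq_nonneg (|v t| - |w t|), sq_abs (v t), sq_abs (w t)]
    have h3 : |w t * v t| = |v t| * |w t| := by rw [abs_mul, mul_comm]
    have h4 := mul_le_mul_of_nonneg_left h2 hK
    have h5 : 0 ≤ a * w t ^ 2 := by positivity
    have h6 : 0 ≤ a * v t ^ 2 := by positivity
    rw [abs_le] at h1 ⊢
    have h7 := abs_le.1 h3.le
    constructor <;> nlinarith
  have hzero : (fun t => (w t ^ 2 + v t ^ 2) * exp (C * t)) t₀ = 0 ∧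
      (fun t => (w t ^ 2 + v t ^ 2) * exp (-C * t)) t₀ = 0 := by simp [hw0, hv0]
  have key : ∀ t ∈ Icc α β, w t ^ 2 + v t ^ 2 ≤ 0 := by
    intro t ht
    rcases le_total t t₀ with h | h
    · have := monotoneOn_of_hasDerivAt_nonneg (convex_Icc α β) (hder C) (fun s hs => by
        have := abs_le.1 (hbound s hs)
        exact mul_nonneg (by linarith) (exp_pos _).le) ht ht₀ h
      rw [hzero.1] at this
      exact nonpos_of_mul_nonpos_left this (exp_pos _)
    · have := antitoneOn_of_hasDerivAt_nonpos (convex_Icc α β) (hder (-C)) (fun s hs => by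
        have := abs_le.1 (hbound s hs)
        exact mul_nonpos_of_nonpos_of_nonneg (by linarith) (exp_pos _).le) ht₀ ht h
      rw [hzero.2] at this
      exact nonpos_of_mul_nonpos_left this (exp_pos _)
  intro t ht
  have := key t ht
  have h : w t ^ 2 = 0 := le_antisymm (by nlinarith [sq_nonneg (v t)]) (sq_nonneg _)
  exact pow_eq_zero_iff two_ne_zero |>.1 h

lemma abs_rpow_sub_rpow_le {p M x y : ℝ} (hp : 1 < p) (hx : x ∈ Icc 0 M) (hy : y ∈ Icc 0 M) :
    |x ^ p - y ^ p| ≤ p * M ^ (p - 1) * |x - y| := by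
  have h := (convex_Icc (0 : ℝ) M).norm_image_sub_le_of_norm_hasDerivWithin_le
    (f := fun x => x ^ p) (f' := fun x => p * x ^ (p - 1)) (C := p * M ^ (p - 1))
    (fun z _ => (hasDerivAt_rpow_const (Or.inr hp.le)).hasDerivWithinAt) (fun z hz => by
      have h1 : 0 ≤ z ^ (p - 1) := rpow_nonneg hz.1 _
      rw [Real.norm_eq_abs, abs_of_nonneg (by positivity)]
      have := rpow_le_rpow hz.1 hz.2 (by linarith : 0 ≤ p - 1)
      nlinarith) hy hx
  simpa [Real.norm_eq_abs] using h

/-- Near `u = 1` the function `u ^ p - p * u` is Lipschitz with an arbitrarily small constant. -/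
lemma exists_abs_rpow_sub_linear_le (p : ℝ) {ε : ℝ} (hε : 0 < ε) :
    ∃ δ > 0, ∀ x y : ℝ, |x - 1| < δ → |y - 1| < δ →
      |(x ^ p - p * x) - (y ^ p - p * y)| ≤ ε * |x - y| := by
  have h : HasStrictDerivAt (fun x : ℝ => x ^ p - p * x) 0 1 := by
    have h1 := (Real.hasStrictDerivAt_rpow_const_of_ne (x := 1) one_ne_zero p).sub
      ((hasStrictDerivAt_id (1 : ℝ)).const_mul p)
    simp only [one_rpow, mul_one, sub_self] at h1
    exact h1
  have h2 := (hasStrictFDerivAt_iff_isLittleO.1 h.hasStrictFDerivAt).bound hε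
  obtain ⟨δ, hδ, h3⟩ := Metric.eventually_nhds_iff.1 h2
  refine ⟨δ, hδ, fun x y hx hy => ?_⟩
  have := h3 (y := (x, y)) (by
    rw [Prod.dist_eq]
    exact max_lt hx hy)
  simpa [Real.norm_eq_abs] using this

/-- `y`, with derivative `v`, is a positive solution on `(-∞, b)` of
`y'' + a y' + κ (y ^ p - y) - e^{2t} y = 0` tending to `1` at `-∞`. -/
structure EFSol (a κ p b : ℝ) (y v : ℝ → ℝ) : Prop where
  hasDerivAt : ∀ t < b, HasDerivAt y (v t) t
  hasDerivAt' : ∀ t < b,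
    HasDerivAt v (-a * v t - κ * (y t ^ p - y t) + exp (2 * t) * y t) t
  pos : ∀ t < b, 0 < y t
  tendsto : Tendsto y atBot (𝓝 1)

lemma tendsto_exp_two_mul_atBot : Tendsto (fun t : ℝ => exp (2 * t)) atBot (𝓝 0) :=
  tendsto_exp_atBot.comp (tendsto_id.const_mul_atBot two_pos)

/-- A function whose difference quotients control a quadratic form: if `w → 0` at `-∞` and the
form `Q(w, w')` is nonincreasing near `-∞` then it is nonpositive there. -/
lemma quadratic_nonpos_of_antitone {a b T : ℝ} {w v : ℝ → ℝ}
    (hw : ∀ t ≤ T, HasDerivAt w (v t) t) (hlim : Tendsto w atBot (𝓝 0))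
    (hQ : AntitoneOn (fun t => v t ^ 2 + (v t + a * w t) ^ 2 + 2 * b * w t ^ 2) (Iic T)) :
    ∀ t ≤ T, v t ^ 2 + (v t + a * w t) ^ 2 + 2 * b * w t ^ 2 ≤ 0 := by
  intro t ht
  have hmv : ∀ n : ℕ, ∃ ξ ∈ Ioo (t - n - 1) (t - n), v ξ = w (t - n) - w (t - n - 1) := by
    intro n
    have hn : (0 : ℝ) ≤ n := n.cast_nonneg
    obtain ⟨ξ, hξ, h⟩ := exists_hasDerivAt_eq_slope w v (by linarith : t - n - 1 < t - n)
      (fun s hs => (hw s (by linarith [hs.2])).continuousAt.continuousWithinAt)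
      (fun s hs => hw s (by linarith [hs.2]))
    exact ⟨ξ, hξ, by rw [h]; ring_nf⟩
  choose ξ hξ hvξ using hmv
  have hbot : Tendsto (fun n : ℕ => t - (n : ℝ)) atTop atBot := by
    have := tendsto_neg_atTop_atBot.comp (tendsto_natCast_atTop_atTop (R := ℝ))
    exact tendsto_atBot_add_const_left _ t this
  have hξbot : Tendsto ξ atTop atBot := tendsto_atBot_mono (fun n => (hξ n).2.le) hbot
  have h1 : Tendsto (fun n => w (ξ n)) atTop (𝓝 0) := hlim.comp hξbot
  have h2 : Tendsto (fun n => v (ξ n)) atTop (𝓝 0) := by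
    have h3 := (hlim.comp hbot).sub
      (hlim.comp (tendsto_atBot_add_const_right _ (-1) hbot))
    rw [sub_zero] at h3
    exact h3.congr fun n => (hvξ n).symm
  have h3 : Tendsto (fun n => v (ξ n) ^ 2 + (v (ξ n) + a * w (ξ n)) ^ 2 + 2 * b * w (ξ n) ^ 2)
      atTop (𝓝 0) := by
    have := ((h2.pow 2).add ((h2.add (h1.const_mul a)).pow 2)).add ((h1.pow 2).const_mul (2 * b))
    simpa using this
  refine ge_of_tendsto h3 (Eventually.of_forall fun n => ?_)
  have hn : (0 : ℝ) ≤ n := n.cast_nonneg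
  have hle : ξ n ≤ t := by linarith [(hξ n).2]
  exact hQ (mem_Iic.2 (hle.trans ht)) (mem_Iic.2 ht) hle

lemma EFSol.unique {a κ p b : ℝ} (ha : 0 < a) (hκ : 0 < κ) (hp : 1 < p) {y₁ v₁ y₂ v₂ : ℝ → ℝ}
    (h₁ : EFSol a κ p b y₁ v₁) (h₂ : EFSol a κ p b y₂ v₂) : ∀ t < b, y₁ t = y₂ t := by
  set β := κ * (p - 1) with hβ
  have hβ0 : 0 < β := mul_pos hκ (by linarith)
  set ε := min a (a * β / (1 + a)) with hε
  have hε0 : 0 < ε := lt_min ha (by positivity)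
  have hε1 : ε ≤ a := min_le_left _ _
  have hε2 : ε * (1 + a) ≤ a * β := by
    have : ε ≤ a * β / (1 + a) := min_le_right _ _
    rwa [le_div_iff₀ (by linarith)] at this
  obtain ⟨δ, hδ, hlip⟩ := exists_abs_rpow_sub_linear_le p (ε := ε / (2 * κ)) (by positivity)
  have hclose : ∀ᶠ t in atBot, |y₁ t - 1| < δ ∧ |y₂ t - 1| < δ ∧ exp (2 * t) < ε / 2 ∧ t < b := by
    refine (Metric.tendsto_nhds.1 h₁.tendsto δ hδ).and
      ((Metric.tendsto_nhds.1 h₂.tendsto δ hδ).and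
      ((tendsto_exp_two_mul_atBot.eventually_lt_const (by positivity)).and (eventually_lt_atBot b)))
  obtain ⟨T, hT⟩ := eventually_atBot.1 hclose
  set w : ℝ → ℝ := fun t => y₁ t - y₂ t with hw
  set v : ℝ → ℝ := fun t => v₁ t - v₂ t with hv
  set q : ℝ → ℝ := fun t => κ * (y₁ t ^ p - y₁ t) - κ * (y₂ t ^ p - y₂ t) - exp (2 * t) * w t
    with hq
  have hdw : ∀ t < b, HasDerivAt w (v t) t := fun t ht =>
    (h₁.hasDerivAt t ht).sub (h₂.hasDerivAt t ht)
  have hdv : ∀ t < b, HasDerivAt v (-a * v t - q t) t := fun t ht =>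
    ((h₁.hasDerivAt' t ht).sub (h₂.hasDerivAt' t ht)).congr_deriv (by simp only [hw, hv, hq]; ring)
  have hqr : ∀ t ≤ T, |q t - β * w t| ≤ ε * |w t| := by
    intro t ht
    obtain ⟨c1, c2, c3, -⟩ := hT t ht
    have e1 := mul_le_mul_of_nonneg_left (hlip _ _ c1 c2) hκ.le
    rw [show κ * (ε / (2 * κ) * |y₁ t - y₂ t|) = ε / 2 * |w t| by simp only [hw]; field_simp] at e1
    have e2 : q t - β * w t = κ * ((y₁ t ^ p - p * y₁ t) - (y₂ t ^ p - p * y₂ t))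
        - exp (2 * t) * w t := by
      simp only [hq, hw, hβ]; ring
    rw [e2]
    refine (abs_sub _ _).trans ?_
    rw [abs_mul, abs_mul, abs_of_pos hκ, abs_of_pos (exp_pos _)]
    nlinarith [abs_nonneg (w t)]
  have hanti : AntitoneOn (fun t => v t ^ 2 + (v t + a * w t) ^ 2 + 2 * β * w t ^ 2) (Iic T) := by
    refine antitoneOn_of_hasDerivAt_nonpos (convex_Iic T)
      (f' := fun t => -2 * a * (v t ^ 2 + β * w t ^ 2) - (4 * v t + 2 * a * w t) *
        (q t - β * w t)) (fun t ht => ?_) (fun t ht => ?_)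
    · have htb := (hT t ht).2.2.2
      have := (((hdv t htb).pow 2).add
        (((hdv t htb).add ((hdw t htb).const_mul a)).pow 2)).add
        (((hdw t htb).pow 2).const_mul (2 * β))
      refine this.congr_deriv ?_
      simp only [Pi.add_apply]
      push_cast
      ring
    · have h1 := hqr t ht
      set r := q t - β * w t
      have h2 : |(4 * v t + 2 * a * w t) * r| ≤ (4 * |v t| + 2 * a * |w t|) * (ε * |w t|) := by
        rw [abs_mul]
        refine mul_le_mul ((abs_add_le _ _).trans ?_) h1 (abs_nonneg _) (by positivity)
        rw [abs_mul, abs_mul, abs_of_pos (by positivity : 0 < 2 * a)]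
        norm_num
      have h3 : 2 * (|v t| * |w t|) ≤ v t ^ 2 + w t ^ 2 := by
        nlinarith [sq_nonneg (|v t| - |w t|), sq_abs (v t), sq_abs (w t)]
      have h4 := (abs_le.1 h2).1
      have h5 : (4 * |v t| + 2 * a * |w t|) * (ε * |w t|) =
          2 * (ε * (2 * (|v t| * |w t|))) + 2 * a * ε * w t ^ 2 := by
        rw [← sq_abs (w t)]; ring
      have h6 := mul_le_mul_of_nonneg_left h3 hε0.le
      have h7 := mul_le_mul_of_nonneg_right hε1 (sq_nonneg (v t))
      have h8 := mul_le_mul_of_nonneg_right hε2 (sq_nonneg (w t))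
      nlinarith
  have hlim : Tendsto w atBot (𝓝 0) := by simpa using h₁.tendsto.sub h₂.tendsto
  have hQ := quadratic_nonpos_of_antitone (fun t ht => hdw t (hT t ht).2.2.2) hlim hanti
  have hz : ∀ t ≤ T, w t = 0 ∧ v t = 0 := by
    intro t ht
    have h := hQ t ht
    have h1 : 0 ≤ β * w t ^ 2 := by positivity
    have h2 : β * w t ^ 2 = 0 := by nlinarith [sq_nonneg (v t), sq_nonneg (v t + a * w t)]
    have h3 : v t ^ 2 = 0 := by nlinarith [sq_nonneg (v t), sq_nonneg (v t + a * w t)]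
    simpa [hβ0.ne'] using And.intro h2 h3
  intro t ht
  rcases le_total t T with h | h
  · exact sub_eq_zero.1 (hz t h).1
  have hIcc : ∀ s ∈ Icc T t, s < b := fun s hs => hs.2.trans_lt ht
  obtain ⟨M₁, hM₁⟩ := (isCompact_Icc (a := T) (b := t)).exists_bound_of_continuousOn
    (fun s hs => (h₁.hasDerivAt s (hIcc s hs)).continuousAt.continuousWithinAt)
  obtain ⟨M₂, hM₂⟩ := (isCompact_Icc (a := T) (b := t)).exists_bound_of_continuousOn
    (fun s hs => (h₂.hasDerivAt s (hIcc s hs)).continuousAt.continuousWithinAt)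
  set M := max M₁ M₂
  have hm₁ : ∀ s ∈ Icc T t, y₁ s ∈ Icc 0 M := fun s hs =>
    ⟨(h₁.pos s (hIcc s hs)).le, (le_abs_self _).trans ((hM₁ s hs).trans (le_max_left _ _))⟩
  have hm₂ : ∀ s ∈ Icc T t, y₂ s ∈ Icc 0 M := fun s hs =>
    ⟨(h₂.pos s (hIcc s hs)).le, (le_abs_self _).trans ((hM₂ s hs).trans (le_max_right _ _))⟩
  have hM0 : 0 ≤ M := (hm₁ T ⟨le_rfl, h⟩).1.trans (hm₁ T ⟨le_rfl, h⟩).2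
  have hp0 : 0 ≤ p * M ^ (p - 1) := mul_nonneg (by linarith) (rpow_nonneg hM0 _)
  have hfin := second_order_eq_zero (w := w) (v := v) (q := q) (t₀ := T)
    (K := κ * (p * M ^ (p - 1)) + κ + exp (2 * t)) ha.le (by positivity)
    (fun s hs => hdw s (hIcc s hs)) (fun s hs => hdv s (hIcc s hs)) (fun s hs => by
      have e1 := abs_rpow_sub_rpow_le hp (hm₁ s hs) (hm₂ s hs)
      have e2 : q s = κ * (y₁ s ^ p - y₂ s ^ p) - κ * w s - exp (2 * s) * w s := by
        simp only [hq, hw]; ring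
      have e3 : exp (2 * s) ≤ exp (2 * t) := exp_le_exp.2 (by linarith [hs.2])
      rw [e2]
      refine (abs_sub _ _).trans ((add_le_add_left (abs_sub _ _) _).trans ?_)
      rw [abs_mul, abs_mul, abs_mul, abs_of_pos hκ, abs_of_pos (exp_pos _)]
      have e4 := mul_le_mul_of_nonneg_left e1 hκ.le
      have e5 := mul_le_mul_of_nonneg_right e3 (abs_nonneg (w s))
      have e6 : |y₁ s - y₂ s| = |w s| := rfl
      rw [e6] at e4
      linarith) ⟨le_rfl, h⟩ (hz T le_rfl).1 (hz T le_rfl).2 t ⟨h, le_rfl⟩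
  exact sub_eq_zero.1 hfin

/-! ### Existence of the solution emanating from the equilibrium at `-∞` -/

/-- The energy of `y'' + a y' + κ (y ^ p - y) - e^{2t} y = 0`. -/
def efEnergy (κ p t y v : ℝ) : ℝ :=
  v ^ 2 / 2 + κ * (y ^ (p + 1) / (p + 1) - y ^ 2 / 2) - exp (2 * t) * y ^ 2 / 2

/-- The energy of the equilibrium `y = 1` at time `-∞`. -/
def efMin (κ p : ℝ) : ℝ := κ * (1 / (p + 1) - 1 / 2)

lemma efMin_neg {κ p : ℝ} (hκ : 0 < κ) (hp : 1 < p) : efMin κ p < 0 := by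
  refine mul_neg_of_pos_of_neg hκ ?_
  rw [sub_neg, div_lt_div_iff₀ (by linarith) two_pos]
  linarith

lemma potential_pos {p y : ℝ} (hp : 1 < p) (hy : 0 ≤ y) (hy1 : y ≠ 1) :
    0 < y ^ (p + 1) / (p + 1) - y ^ 2 / 2 - (1 / (p + 1) - 1 / 2) := by
  have h := one_add_mul_self_lt_rpow_one_add (s := y ^ 2 - 1) (p := (p + 1) / 2)
    (by nlinarith [sq_nonneg y]) (by
      intro h0
      have : (y - 1) * (y + 1) = 0 := by linarith
      rcases mul_eq_zero.1 this with h | h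
      · exact hy1 (by linarith)
      · linarith) (by linarith)
  rw [add_sub_cancel, ← rpow_natCast, ← rpow_mul hy] at h
  rw [show ((2 : ℕ) : ℝ) * ((p + 1) / 2) = p + 1 by push_cast; ring, rpow_natCast] at h
  have hp1 : 0 < p + 1 := by linarith
  have : y ^ (p + 1) / (p + 1) - y ^ 2 / 2 - (1 / (p + 1) - 1 / 2) =
      (y ^ (p + 1) - (1 + (p + 1) / 2 * (y ^ 2 - 1))) / (p + 1) := by field_simp; ring
  rw [this]
  exact div_pos (by linarith) hp1

lemma potential_nonneg {p y : ℝ} (hp : 1 < p) (hy : 0 ≤ y) :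
    0 ≤ y ^ (p + 1) / (p + 1) - y ^ 2 / 2 - (1 / (p + 1) - 1 / 2) := by
  rcases eq_or_ne y 1 with rfl | h
  · simp
  · exact (potential_pos hp hy h).le

/-- The power `y ^ p` truncated outside `[0, M]`. -/
def truncPow (M p y : ℝ) : ℝ := max 0 (min M y) ^ p

lemma truncPow_eq {M p y : ℝ} (hy : y ∈ Icc 0 M) : truncPow M p y = y ^ p := by
  rw [truncPow, min_eq_right hy.2, max_eq_right hy.1]

lemma abs_truncPow_sub_le {M p : ℝ} (hM : 0 ≤ M) (hp : 1 < p) (x y : ℝ) :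
    |truncPow M p x - truncPow M p y| ≤ p * M ^ (p - 1) * |x - y| := by
  have hmem : ∀ x, max 0 (min M x) ∈ Icc 0 M := fun x =>
    ⟨le_max_left _ _, max_le hM (min_le_left _ _)⟩
  refine (abs_rpow_sub_rpow_le hp (hmem x) (hmem y)).trans ?_
  refine mul_le_mul_of_nonneg_left ?_ (mul_nonneg (by linarith) (rpow_nonneg hM _))
  have h := ((LipschitzWith.id (α := ℝ)).const_min M).const_max 0
  simpa [Real.dist_eq] using h.dist_le_mul x y

lemma continuous_truncPow {M p : ℝ} (hp : 1 < p) : Continuous (truncPow M p) :=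
  (continuous_const.max (continuous_const.min continuous_id)).rpow_const
    fun _ => Or.inr (by linarith)

/-- The antiderivative of `truncPow` vanishing at the origin. -/
def truncPot (M p y : ℝ) : ℝ := ∫ x in (0 : ℝ)..y, truncPow M p x

lemma hasDerivAt_truncPot {M p : ℝ} (hp : 1 < p) (y : ℝ) :
    HasDerivAt (truncPot M p) (truncPow M p y) y :=
  intervalIntegral.integral_hasDerivAt_right
    ((continuous_truncPow hp).intervalIntegrable _ _)
    ((continuous_truncPow hp).stronglyMeasurableAtFilter _ _) (continuous_truncPow hp).continuousAt

lemma truncPot_eq {M p y : ℝ} (hp : 1 < p) (hy : y ∈ Icc 0 M) :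
    truncPot M p y = y ^ (p + 1) / (p + 1) := by
  rw [truncPot, intervalIntegral.integral_congr (g := fun x => x ^ p),
    integral_rpow (Or.inl (by linarith)), zero_rpow (by linarith), sub_zero]
  intro x hx
  rw [uIcc_of_le hy.1] at hx
  exact truncPow_eq ⟨hx.1, hx.2.trans hy.2⟩

/-- First order system for the equation truncated to `0 ≤ y ≤ M` and frozen after time `T`. -/
def truncField (a κ p M T t : ℝ) (x : ℝ × ℝ) : ℝ × ℝ :=
  (x.2, -a * x.2 - κ * (truncPow M p x.1 - x.1) + exp (2 * min t T) * x.1)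

lemma exists_truncField_lipschitz {a κ p M T : ℝ} (ha : 0 < a) (hκ : 0 < κ) (hp : 1 < p)
    (hM : 0 ≤ M) : ∃ K : NNReal, ∀ t, LipschitzWith K (truncField a κ p M T t) := by
  have hp0 : 0 ≤ p * M ^ (p - 1) := mul_nonneg (by linarith) (rpow_nonneg hM _)
  set C := 1 + a + κ * (p * M ^ (p - 1)) + κ + exp (2 * T) with hC
  have hC0 : 0 ≤ C := by positivity
  refine ⟨Real.toNNReal C, fun t => LipschitzWith.of_dist_le_mul fun x y => ?_⟩
  rw [Real.coe_toNNReal _ hC0, dist_eq_norm, dist_eq_norm, Prod.norm_def, Prod.norm_def]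
  simp only [truncField, Prod.fst_sub, Prod.snd_sub, Real.norm_eq_abs]
  set m := max |x.1 - y.1| |x.2 - y.2| with hm
  have h1 : |x.1 - y.1| ≤ m := le_max_left _ _
  have h2 : |x.2 - y.2| ≤ m := le_max_right _ _
  have hm0 : 0 ≤ m := (abs_nonneg _).trans h1
  have h3 := abs_truncPow_sub_le (p := p) hM hp x.1 y.1
  have h4 : exp (2 * min t T) ≤ exp (2 * T) := exp_le_exp.2 (by linarith [min_le_right t T])
  have h5 := exp_pos (2 * min t T)
  have hCm : C * m = m + a * m + κ * (p * M ^ (p - 1) * m) + κ * m + exp (2 * T) * m := by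
    rw [hC]; ring
  refine max_le ?_ ?_
  · rw [hCm]
    have : 0 ≤ a * m + κ * (p * M ^ (p - 1) * m) + κ * m + exp (2 * T) * m := by positivity
    linarith
  · have e : -a * x.2 - κ * (truncPow M p x.1 - x.1) + exp (2 * min t T) * x.1 -
        (-a * y.2 - κ * (truncPow M p y.1 - y.1) + exp (2 * min t T) * y.1) =
        -(a * (x.2 - y.2)) - κ * (truncPow M p x.1 - truncPow M p y.1) + κ * (x.1 - y.1) +
          exp (2 * min t T) * (x.1 - y.1) := by ring
    rw [e]
    refine (abs_add_le _ _).trans ((add_le_add_left ((abs_add_le _ _).trans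
      (add_le_add_left (abs_sub _ _) _)) _).trans ?_)
    rw [abs_neg, abs_mul, abs_mul, abs_mul, abs_mul, abs_of_pos ha, abs_of_pos hκ, abs_of_pos h5]
    rw [hCm]
    have e1 := mul_le_mul_of_nonneg_left h2 ha.le
    have e2 := mul_le_mul_of_nonneg_left (h3.trans (mul_le_mul_of_nonneg_left h1 hp0)) hκ.le
    have e3 := mul_le_mul_of_nonneg_left h1 hκ.le
    have e4 := mul_le_mul h4 h1 (abs_nonneg _) (exp_pos _).le
    linarith

lemma continuous_truncField (a κ p M T : ℝ) (x : ℝ × ℝ) :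
    Continuous fun t => truncField a κ p M T t x := by
  unfold truncField
  fun_prop

/-- The truncation level preserved by the energy up to time `T`. -/
lemma exists_truncation_level {κ p : ℝ} (hκ : 0 < κ) (hp : 1 < p) (T : ℝ) :
    ∃ M : ℝ, 1 < M ∧ κ * (M ^ (p + 1) / (p + 1) - M ^ 2 / 2) - exp (2 * T) * M ^ 2 / 2 = 0 := by
  set B := (p + 1) * (κ + exp (2 * T)) / (2 * κ) with hB
  have hB1 : 1 < B := by
    rw [hB, one_lt_div (by positivity)]
    nlinarith [exp_pos (2 * T)]
  have hB0 : 0 < B := by linarith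
  refine ⟨B ^ (1 / (p - 1)), one_lt_rpow hB1 (by simpa using hp), ?_⟩
  set M := B ^ (1 / (p - 1)) with hM
  have hM0 : 0 < M := rpow_pos_of_pos hB0 _
  have hMp : M ^ (p - 1) = B := by
    rw [hM, ← rpow_mul hB0.le, one_div, inv_mul_cancel₀ (by linarith), rpow_one]
  have hMp1 : M ^ (p + 1) = B * M ^ 2 := by
    rw [← hMp, ← rpow_natCast, ← rpow_add hM0]
    congr 1
    push_cast
    ring
  rw [hMp1, hB]
  have : p + 1 ≠ 0 := by linarith
  field_simp
  ring

lemma truncField_energy_le {a κ p M T s t : ℝ} (ha : 0 < a) (hp : 1 < p)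
    {X : ℝ → ℝ × ℝ} (hX : ∀ t, HasDerivAt X (truncField a κ p M T t (X t)) t)
    (hst : s ≤ t) (htT : t ≤ T) :
    (X t).2 ^ 2 / 2 + κ * (truncPot M p (X t).1 - (X t).1 ^ 2 / 2)
        - exp (2 * t) * (X t).1 ^ 2 / 2 ≤
      (X s).2 ^ 2 / 2 + κ * (truncPot M p (X s).1 - (X s).1 ^ 2 / 2)
        - exp (2 * s) * (X s).1 ^ 2 / 2 := by
  have hy : ∀ t, HasDerivAt (fun t => (X t).1) (X t).2 t := fun t =>
    (ContinuousLinearMap.fst ℝ ℝ ℝ).hasFDerivAt.comp_hasDerivAt t (hX t)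
  have hv : ∀ t, HasDerivAt (fun t => (X t).2) (-a * (X t).2 - κ * (truncPow M p (X t).1 - (X t).1)
      + exp (2 * min t T) * (X t).1) t := fun t =>
    (ContinuousLinearMap.snd ℝ ℝ ℝ).hasFDerivAt.comp_hasDerivAt t (hX t)
  refine antitoneOn_of_hasDerivAt_nonpos (convex_Iic T)
    (f := fun t => (X t).2 ^ 2 / 2 + κ * (truncPot M p (X t).1 - (X t).1 ^ 2 / 2)
        - exp (2 * t) * (X t).1 ^ 2 / 2)
    (f' := fun t => -a * (X t).2 ^ 2 - exp (2 * t) * (X t).1 ^ 2) (fun r hr => ?_) (fun r _ => ?_)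
    (hst.trans htT) htT hst
  · have h1 : HasDerivAt (fun t : ℝ => exp (2 * t)) (exp (2 * r) * 2) r := by
      simpa using ((hasDerivAt_id r).const_mul 2).exp
    have h2 := (hasDerivAt_truncPot (M := M) hp (X r).1).comp r (hy r)
    have h3 := ((((hv r).pow 2).div_const 2).add
      ((h2.sub (((hy r).pow 2).div_const 2)).const_mul κ)).sub
      ((h1.mul ((hy r).pow 2)).div_const 2)
    refine h3.congr_deriv ?_
    rw [min_eq_left hr]
    simp only [Pi.pow_apply]
    push_cast
    ring
  · have := mul_nonneg ha.le (sq_nonneg (X r).2)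
    have := mul_nonneg (exp_pos (2 * r)).le (sq_nonneg (X r).1)
    linarith

/-- A truncated solution starting at rest at `y = 1` stays in the untruncated region. -/
lemma truncField_invariant {a κ p M T s : ℝ} (ha : 0 < a) (hκ : 0 < κ) (hp : 1 < p) (hM : 1 < M)
    (hMT : κ * (M ^ (p + 1) / (p + 1) - M ^ 2 / 2) - exp (2 * T) * M ^ 2 / 2 = 0)
    {X : ℝ → ℝ × ℝ} (hX : ∀ t, HasDerivAt X (truncField a κ p M T t (X t)) t)
    (hXs : X s = (1, 0)) {t : ℝ} (ht : t ∈ Icc s T) :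
    (X t).1 ∈ Icc 0 M ∧ efEnergy κ p t (X t).1 (X t).2 ≤ efMin κ p := by
  have hone : truncPot M p 1 = 1 / (p + 1) := by
    rw [truncPot_eq hp ⟨zero_le_one, hM.le⟩, one_rpow]
  have hE : ∀ t ∈ Icc s T, (X t).2 ^ 2 / 2 + κ * (truncPot M p (X t).1 - (X t).1 ^ 2 / 2)
        - exp (2 * t) * (X t).1 ^ 2 / 2 ≤ efMin κ p := by
    intro t ht
    refine (truncField_energy_le ha hp hX ht.1 ht.2).trans ?_
    rw [hXs]
    simp only [hone, efMin]
    have := exp_pos (2 * s)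
    linarith
  have hneg := efMin_neg hκ hp
  have hcont : Continuous fun t => (X t).1 :=
    continuous_fst.comp (continuous_iff_continuousAt.2 fun t => (hX t).continuousAt)
  have hne0 : ∀ t ∈ Icc s T, (X t).1 ≠ 0 := by
    intro t ht h0
    have h := hE t ht
    rw [h0, truncPot_eq hp ⟨le_rfl, by linarith⟩, zero_rpow (by linarith)] at h
    norm_num at h
    linarith [sq_nonneg (X t).2]
  have hneM : ∀ t ∈ Icc s T, (X t).1 ≠ M := by
    intro t ht h0
    have h := hE t ht
    rw [h0, truncPot_eq hp ⟨by linarith, le_rfl⟩] at h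
    have h1 : exp (2 * t) ≤ exp (2 * T) := exp_le_exp.2 (by linarith [ht.2])
    nlinarith [sq_nonneg (X t).2, mul_le_mul_of_nonneg_right h1 (sq_nonneg M)]
  have hmem : (X t).1 ∈ Icc 0 M := by
    constructor
    · by_contra! hlt
      obtain ⟨r, hr, hr0⟩ := intermediate_value_Icc' ht.1 hcont.continuousOn
        (show (0 : ℝ) ∈ Icc (X t).1 (X s).1 from ⟨hlt.le, by rw [hXs]; exact zero_le_one⟩)
      exact hne0 r ⟨hr.1, hr.2.trans ht.2⟩ hr0
    · by_contra! hlt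
      obtain ⟨r, hr, hr0⟩ := intermediate_value_Icc ht.1 hcont.continuousOn
        (show M ∈ Icc (X s).1 (X t).1 from ⟨by rw [hXs]; exact hM.le, hlt.le⟩)
      exact hneM r ⟨hr.1, hr.2.trans ht.2⟩ hr0
  refine ⟨hmem, ?_⟩
  have h := hE t ht
  rwa [truncPot_eq hp hmem] at h

lemma sq_le_of_efEnergy_le {κ p M T t y v : ℝ} (hκ : 0 < κ) (hp : 1 < p) (ht : t ≤ T)
    (hy : y ∈ Icc 0 M) (h : efEnergy κ p t y v ≤ efMin κ p) :
    v ^ 2 ≤ (κ + exp (2 * T)) * M ^ 2 := by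
  have h1 := efMin_neg hκ hp
  have h2 : 0 ≤ κ * (y ^ (p + 1) / (p + 1)) :=
    mul_nonneg hκ.le (div_nonneg (rpow_nonneg hy.1 _) (by linarith))
  have h3 : exp (2 * t) ≤ exp (2 * T) := exp_le_exp.2 (by linarith)
  have h4 : y ^ 2 ≤ M ^ 2 := pow_le_pow_left₀ hy.1 hy.2 2
  have h5 := mul_le_mul h3 h4 (sq_nonneg y) (exp_pos _).le
  have h6 := mul_le_mul_of_nonneg_left h4 hκ.le
  unfold efEnergy at h
  linarith

lemma tendsto_one_of_efEnergy_le {κ p M T : ℝ} (hκ : 0 < κ) (hp : 1 < p) {y v : ℝ → ℝ}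
    (hy : ∀ t ≤ T, y t ∈ Icc 0 M) (h : ∀ t ≤ T, efEnergy κ p t (y t) (v t) ≤ efMin κ p) :
    Tendsto y atBot (𝓝 1) := by
  set ψ : ℝ → ℝ := fun y => y ^ (p + 1) / (p + 1) - y ^ 2 / 2 - (1 / (p + 1) - 1 / 2) with hψ
  have hψc : Continuous ψ := by
    have : Continuous fun y : ℝ => y ^ (p + 1) :=
      continuous_id.rpow_const fun _ => Or.inr (by linarith)
    fun_prop
  have hsmall : ∀ t ≤ T, κ * ψ (y t) ≤ exp (2 * t) * (M ^ 2 / 2) := by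
    intro t ht
    have h1 := h t ht
    have h2 : (y t) ^ 2 ≤ M ^ 2 := pow_le_pow_left₀ (hy t ht).1 (hy t ht).2 2
    have h3 := mul_le_mul_of_nonneg_left h2 (exp_pos (2 * t)).le
    unfold efEnergy efMin at h1
    simp only [hψ]
    linarith [sq_nonneg (v t)]
  rw [Metric.tendsto_nhds]
  intro ε hε
  have hK : IsCompact (Icc 0 M ∩ {z : ℝ | ε ≤ |z - 1|}) :=
    isCompact_Icc.inter_right (isClosed_le continuous_const (by fun_prop))
  have hmin : ∃ m > 0, ∀ z ∈ Icc 0 M ∩ {z : ℝ | ε ≤ |z - 1|}, m ≤ ψ z := by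
    rcases (Icc 0 M ∩ {z : ℝ | ε ≤ |z - 1|}).eq_empty_or_nonempty with he | hne
    · exact ⟨1, one_pos, by simp [he]⟩
    · obtain ⟨z, hz, hzmin⟩ := hK.exists_isMinOn hne hψc.continuousOn
      refine ⟨ψ z, potential_pos hp hz.1.1 ?_, fun x hx => hzmin hx⟩
      rintro rfl
      have := hz.2
      simp only [mem_ofPred_eq, sub_self, abs_zero] at this
      linarith
  obtain ⟨m, hm, hmin⟩ := hmin
  have hlim : Tendsto (fun t : ℝ => exp (2 * t) * (M ^ 2 / 2)) atBot (𝓝 0) := by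
    simpa using tendsto_exp_two_mul_atBot.mul_const (M ^ 2 / 2)
  filter_upwards [hlim.eventually_lt_const (mul_pos hκ hm), eventually_le_atBot T] with t ht htT
  by_contra! hge
  have h1 := hmin (y t) ⟨hy t htT, hge⟩
  have h2 := mul_le_mul_of_nonneg_left h1 hκ.le
  linarith [hsmall t htT]

lemma exists_efSol_below {a κ p : ℝ} (ha : 0 < a) (hκ : 0 < κ) (hp : 1 < p) (T : ℝ) :
    ∃ y v : ℝ → ℝ, EFSol a κ p T y v ∧ ∀ t < T, efEnergy κ p t (y t) (v t) ≤ efMin κ p := by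
  obtain ⟨M, hM, hMT⟩ := exists_truncation_level hκ hp T
  obtain ⟨K, hK⟩ := exists_truncField_lipschitz (M := M) (T := T) ha hκ hp (by linarith)
  have hc := continuous_truncField a κ p M T
  choose X hX0 hX using fun n : ℕ => exists_global_solution hK hc (-(n : ℝ)) (1, 0)
  have hinv : ∀ (n : ℕ) (t : ℝ), t ∈ Icc (-(n : ℝ)) T →
      (X n t).1 ∈ Icc 0 M ∧ efEnergy κ p t (X n t).1 (X n t).2 ≤ efMin κ p :=
    fun n t ht => truncField_invariant ha hκ hp hM hMT (hX n) (hX0 n) ht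
  set C := √((κ + exp (2 * T)) * M ^ 2)
  obtain ⟨n₀, hn₀⟩ := exists_nat_ge (-T)
  have hcompact : IsCompact (Icc 0 M ×ˢ Icc (-C) C) := isCompact_Icc.prod isCompact_Icc
  obtain ⟨x, -, φ, hφ, hlim⟩ := hcompact.tendsto_subseq (x := fun n => X (n₀ + n) T) (fun n => by
    have h1 := hinv (n₀ + n) T ⟨by push_cast; linarith [n.cast_nonneg (α := ℝ)], le_rfl⟩
    exact ⟨h1.1, abs_le.1 (abs_le_sqrt (sq_le_of_efEnergy_le hκ hp le_rfl h1.1 h1.2))⟩)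
  obtain ⟨Y, hYT, hY⟩ := exists_global_solution hK hc T x
  have hconv : ∀ t ≤ T, Tendsto (fun n => X (n₀ + φ n) t) atTop (𝓝 (Y t)) := by
    intro t ht
    rw [tendsto_iff_dist_tendsto_zero]
    have h1 : Tendsto (fun n => dist (X (n₀ + φ n) T) (Y T) * exp (K * (T - t))) atTop (𝓝 0) := by
      rw [hYT]
      simpa using (tendsto_iff_dist_tendsto_zero.1 hlim).mul_const (exp (K * (T - t)))
    exact squeeze_zero (fun _ => dist_nonneg) (fun n => dist_le_backward hK (hX _) hY ht) h1
  have hev : ∀ t ≤ T, ∀ᶠ n in atTop, (X (n₀ + φ n) t).1 ∈ Icc 0 M ∧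
      efEnergy κ p t (X (n₀ + φ n) t).1 (X (n₀ + φ n) t).2 ≤ efMin κ p := by
    intro t ht
    filter_upwards [(tendsto_natCast_atTop_atTop.comp hφ.tendsto_atTop).eventually_ge_atTop (-t)]
      with n hn
    refine hinv _ t ⟨?_, ht⟩
    have : (0 : ℝ) ≤ n₀ := n₀.cast_nonneg
    simp only [Function.comp_apply] at hn
    push_cast
    linarith
  have hmem : ∀ t ≤ T, (Y t).1 ∈ Icc 0 M := fun t ht =>
    isClosed_Icc.mem_of_tendsto ((continuous_fst.tendsto _).comp (hconv t ht))
      ((hev t ht).mono fun n hn => hn.1)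
  have hen : ∀ t ≤ T, efEnergy κ p t (Y t).1 (Y t).2 ≤ efMin κ p := by
    intro t ht
    have hcont : Continuous fun z : ℝ × ℝ => efEnergy κ p t z.1 z.2 := by
      have : Continuous fun y : ℝ × ℝ => y.1 ^ (p + 1) :=
        continuous_fst.rpow_const fun _ => Or.inr (by linarith)
      unfold efEnergy
      fun_prop
    exact le_of_tendsto ((hcont.tendsto _).comp (hconv t ht)) ((hev t ht).mono fun n hn => hn.2)
  refine ⟨fun t => (Y t).1, fun t => (Y t).2, ⟨fun t _ => ?_, fun t ht => ?_, fun t ht => ?_,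
    tendsto_one_of_efEnergy_le hκ hp hmem hen⟩, fun t ht => hen t ht.le⟩
  · exact (ContinuousLinearMap.fst ℝ ℝ ℝ).hasFDerivAt.comp_hasDerivAt t (hY t)
  · refine ((ContinuousLinearMap.snd ℝ ℝ ℝ).hasFDerivAt.comp_hasDerivAt t (hY t)).congr_deriv ?_
    simp [truncField, truncPow_eq (hmem t ht.le), min_eq_left ht.le]
  · refine lt_of_le_of_ne (hmem t ht.le).1 fun h0 => ?_
    have h1 := hen t ht.le
    rw [← h0, efEnergy, zero_rpow (by linarith)] at h1
    norm_num at h1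
    linarith [efMin_neg hκ hp, sq_nonneg (Y t).2]

lemma exists_efSol {a κ p : ℝ} (ha : 0 < a) (hκ : 0 < κ) (hp : 1 < p) :
    ∃ y v : ℝ → ℝ, (∀ b, EFSol a κ p b y v) ∧
      ∀ t, efEnergy κ p t (y t) (v t) ≤ efMin κ p := by
  choose y v hsol hen using fun n : ℕ => exists_efSol_below ha hκ hp (n : ℝ)
  have hyy : ∀ n m : ℕ, n ≤ m → ∀ t : ℝ, t < n → y m t = y n t := by
    intro n m hnm
    have hnm' : (n : ℝ) ≤ m := by exact_mod_cast hnm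
    have h : EFSol a κ p n (y m) (v m) :=
      ⟨fun t ht => (hsol m).hasDerivAt t (ht.trans_le hnm'),
        fun t ht => (hsol m).hasDerivAt' t (ht.trans_le hnm'),
        fun t ht => (hsol m).pos t (ht.trans_le hnm'), (hsol m).tendsto⟩
    exact h.unique ha hκ hp (hsol n)
  have hvv : ∀ n m : ℕ, n ≤ m → ∀ t : ℝ, t < n → v m t = v n t := by
    intro n m hnm t ht
    have hnm' : (n : ℝ) ≤ m := by exact_mod_cast hnm
    refine ((hsol m).hasDerivAt t (ht.trans_le hnm')).unique ?_
    exact ((hsol n).hasDerivAt t ht).congr_of_eventuallyEq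
      ((eventually_lt_nhds ht).mono fun s hs => hyy n m hnm s hs)
  obtain ⟨z, hz⟩ := exists_glue y fun n m hnm t ht => hyy n m hnm t (abs_lt.1 ht).2
  obtain ⟨u, hu⟩ := exists_glue v fun n m hnm t ht => hvv n m hnm t (abs_lt.1 ht).2
  have key : ∀ t : ℝ, ∃ n : ℕ, |t| < n := fun t => exists_nat_gt _
  refine ⟨z, u, fun b => ⟨fun t _ => ?_, fun t _ => ?_, fun t _ => ?_, ?_⟩, fun t => ?_⟩
  · obtain ⟨n, hn⟩ := key t
    rw [hu n t hn]
    exact ((hsol n).hasDerivAt t (abs_lt.1 hn).2).congr_of_eventuallyEq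
      ((eventually_abs_lt hn).mono fun s hs => hz n s hs)
  · obtain ⟨n, hn⟩ := key t
    rw [hu n t hn, hz n t hn]
    exact ((hsol n).hasDerivAt' t (abs_lt.1 hn).2).congr_of_eventuallyEq
      ((eventually_abs_lt hn).mono fun s hs => hu n s hs)
  · obtain ⟨n, hn⟩ := key t
    rw [hz n t hn]
    exact (hsol n).pos t (abs_lt.1 hn).2
  · refine (hsol 1).tendsto.congr' ?_
    filter_upwards [eventually_lt_atBot 0] with t ht
    obtain ⟨n, hn⟩ := key t
    have h1 : 1 ≤ n := by
      by_contra! h0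
      have : n = 0 := by omega
      subst this
      exact absurd hn (by simp)
    rw [hz n t hn, hyy 1 n h1 t (by push_cast; linarith)]
  · obtain ⟨n, hn⟩ := key t
    rw [hz n t hn, hu n t hn]
    exact hen n t (abs_lt.1 hn).2

/-! ### Oscillation around the constant solution -/

lemma pos_or_neg_of_ne_zero {s : Set ℝ} {f : ℝ → ℝ} (hs : IsPreconnected s)
    (hf : ContinuousOn f s) (h0 : ∀ t ∈ s, f t ≠ 0) :
    (∀ t ∈ s, 0 < f t) ∨ ∀ t ∈ s, f t < 0 := by
  by_contra! hcon
  obtain ⟨⟨a, ha, hfa⟩, b, hb, hfb⟩ := hcon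
  obtain ⟨t, ht, hft⟩ := hs.intermediate_value ha hb hf ⟨hfa, hfb⟩
  exact h0 t ht hft

/-- Every interval of length `7` contains a zero of a solution of `x'' + c x' + q x = 0` when `q` is
large compared with `c`. -/
lemma exists_zero_of_large_potential {c t₁ : ℝ} {x v q : ℝ → ℝ}
    (hx : ∀ t ∈ Icc t₁ (t₁ + 7), HasDerivAt x (v t) t)
    (hv : ∀ t ∈ Icc t₁ (t₁ + 7), x t ≠ 0 → HasDerivAt v (-c * v t - q t * x t) t)
    (hq : ∀ t ∈ Icc t₁ (t₁ + 7), x t ≠ 0 → c ^ 2 / 2 + 1 / 2 ≤ q t) :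
    ∃ t ∈ Icc t₁ (t₁ + 7), x t = 0 := by
  by_contra! hne
  have hanti := antitoneOn_of_hasDerivAt_nonpos (convex_Icc t₁ (t₁ + 7))
    (f := fun t => arctan (v t / x t) + t / 2)
    (f' := fun t => 1 / (1 + (v t / x t) ^ 2) *
      (((-c * v t - q t * x t) * x t - v t * v t) / x t ^ 2) + 1 / 2)
    (fun t ht => (((hv t ht (hne t ht)).div (hx t ht) (hne t ht)).arctan).add
      ((hasDerivAt_id t).div_const 2))
    (fun t ht => by
      have h0 := hne t ht
      have h1 := hq t ht h0
      set ρ := v t / x t with hρ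
      have e : ((-c * v t - q t * x t) * x t - v t * v t) / x t ^ 2 = -c * ρ - q t - ρ ^ 2 := by
        rw [hρ]; field_simp
      rw [e]
      have h2 : 0 < 1 + ρ ^ 2 := by positivity
      rw [one_div_mul_eq_div, ← le_neg_iff_add_nonpos_right, div_le_iff₀ h2]
      nlinarith [sq_nonneg (c + ρ)])
  have h := hanti (left_mem_Icc.2 (by linarith)) (right_mem_Icc.2 (by linarith))
    (show t₁ ≤ t₁ + 7 by linarith)
  simp only at h
  have h1 := neg_pi_div_two_lt_arctan (v (t₁ + 7) / x (t₁ + 7))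
  have h2 := arctan_lt_pi_div_two (v t₁ / x t₁)
  linarith [pi_lt_d2]

lemma fNL_mul_sub_one_ge {p u : ℝ} (hp : 1 < p) (hu : 0 < u) :
    min 1 (p - 1) * min u 1 * (u - 1) ^ 2 ≤ fNL p u * (u - 1) := by
  have hm0 : 0 < min 1 (p - 1) := lt_min one_pos (by linarith)
  set m := min 1 (p - 1) with hm
  have hm1 : m ≤ 1 := min_le_left _ _
  have hmp : m ≤ p - 1 := min_le_right _ _
  unfold fNL
  rcases le_total 1 u with h | h
  · rw [min_eq_right h]
    have h1 := one_add_mul_self_le_rpow_one_add (s := u - 1) (by linarith) hp.le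
    rw [add_sub_cancel] at h1
    have h2 : 0 ≤ u - 1 := by linarith
    nlinarith [mul_nonneg h2 (show 0 ≤ (-u + u ^ p) - m * (u - 1) by nlinarith)]
  · rw [min_eq_left h]
    have h1 := rpow_one_add_le_one_add_mul_self (s := u - 1) (by linarith) hm0.le hm1
    rw [add_sub_cancel] at h1
    have h2 : u ^ (p - 1) ≤ u ^ m := rpow_le_rpow_of_exponent_ge hu h hmp
    have h3 : u ^ p = u * u ^ (p - 1) := by
      rw [← rpow_one_add' hu.le (by linarith), add_sub_cancel]
    rw [h3]
    have h4 : 0 ≤ u * (1 - u) := mul_nonneg hu.le (by linarith)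
    nlinarith [mul_nonneg h4 (show 0 ≤ 1 + m * (u - 1) - u ^ (p - 1) by linarith)]

/-- A global positive solution of `W'' + c W' + e^{2t} f(W) = 0` blowing up at `-∞` and not decaying
doubly exponentially. -/
structure FowlerSol (c p : ℝ) (W V : ℝ → ℝ) : Prop where
  hasDerivAt : ∀ t, HasDerivAt W (V t) t
  hasDerivAt' : ∀ t, HasDerivAt V (-c * V t - exp (2 * t) * fNL p (W t)) t
  pos : ∀ t, 0 < W t
  tendsto : Tendsto W atBot atTop
  eventually_neg : ∀ᶠ t in atBot, V t < 0
  not_decay : ∀ k > 0, ∀ C T : ℝ, ∃ t ≥ T, C * exp (-(k * exp t)) < W t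

namespace FowlerSol

variable {c p : ℝ} {W V : ℝ → ℝ}

lemma continuous (h : FowlerSol c p W V) : Continuous W :=
  continuous_iff_continuousAt.2 fun t => (h.hasDerivAt t).continuousAt

lemma continuous' (h : FowlerSol c p W V) : Continuous V :=
  continuous_iff_continuousAt.2 fun t => (h.hasDerivAt' t).continuousAt

lemma ne_one (h : FowlerSol c p W V) (hc : 0 ≤ c) (hp : 1 < p) {τ : ℝ} (hτ : V τ = 0) :
    W τ ≠ 1 := by
  intro h1
  obtain ⟨s, hs, hsτ⟩ := ((h.tendsto.eventually_gt_atTop 1).and (eventually_le_atBot τ)).exists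
  obtain ⟨B, hB⟩ := (isCompact_Icc (a := s) (b := τ)).bddAbove_image h.continuous.continuousOn
  have hWB : ∀ t ∈ Icc s τ, W t ≤ B := fun t ht => hB (mem_image_of_mem _ ht)
  have hB1 : 1 ≤ B := h1 ▸ hWB τ (right_mem_Icc.2 hsτ)
  have hC0 : 0 ≤ 1 + p * B ^ (p - 1) :=
    add_nonneg zero_le_one (mul_nonneg (by linarith) (rpow_nonneg (by linarith) _))
  have := second_order_eq_zero (w := fun t => W t - 1) (v := V)
    (q := fun t => exp (2 * t) * fNL p (W t)) (K := exp (2 * τ) * (1 + p * B ^ (p - 1)))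
    (α := s) (β := τ) hc (by positivity)
    (fun t _ => (h.hasDerivAt t).sub_const 1) (fun t _ => h.hasDerivAt' t) (fun t ht => by
      have e1 := abs_rpow_sub_rpow_le (M := B) hp ⟨(h.pos t).le, hWB t ht⟩
        ⟨zero_le_one, hB1⟩
      rw [one_rpow] at e1
      have e2 : fNL p (W t) = (W t ^ p - 1) - (W t - 1) := by unfold fNL; ring
      have e3 : |fNL p (W t)| ≤ (1 + p * B ^ (p - 1)) * |W t - 1| := by
        rw [e2]
        refine (abs_sub _ _).trans ?_
        linarith
      rw [abs_mul, abs_of_pos (exp_pos _), mul_assoc]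
      exact mul_le_mul (exp_le_exp.2 (by linarith [ht.2])) e3 (abs_nonneg _) (exp_pos _).le)
    (right_mem_Icc.2 hsτ) (by simp [h1]) hτ s (left_mem_Icc.2 hsτ)
  linarith

lemma isolated (h : FowlerSol c p W V) (hc : 0 ≤ c) (hp : 1 < p) {τ : ℝ} (hτ : V τ = 0) :
    ∀ᶠ t in 𝓝[≠] τ, V t ≠ 0 := by
  refine (h.hasDerivAt' τ).eventually_ne ?_
  rw [hτ, mul_zero, zero_sub, neg_ne_zero]
  refine mul_ne_zero (exp_pos _).ne' fun h0 => ?_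
  have h1 := fNL_mul_sub_one_ge hp (h.pos τ)
  have h2 : 0 < min 1 (p - 1) := lt_min one_pos (by linarith)
  have h3 : 0 < min (W τ) 1 := lt_min (h.pos τ) one_pos
  have h4 : 0 < (W τ - 1) ^ 2 := by
    have := sub_ne_zero.2 (h.ne_one hc hp hτ)
    positivity
  rw [h0, zero_mul] at h1
  exact absurd h1 (not_le.2 (by positivity))

/-- Energy in the original radial variable. -/
lemma energy_antitone (h : FowlerSol c p W V) (hc : 0 ≤ c) (hp : 1 < p) :
    Antitone fun t => exp (-(2 * t)) * V t ^ 2 / 2 + (W t ^ (p + 1) / (p + 1) - W t ^ 2 / 2) := by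
  rw [← antitoneOn_univ]
  refine antitoneOn_of_hasDerivAt_nonpos convex_univ
    (f' := fun t => -((1 + c) * exp (-(2 * t)) * V t ^ 2)) (fun t _ => ?_) (fun t _ => ?_)
  · have h1 : HasDerivAt (fun t : ℝ => exp (-(2 * t))) (exp (-(2 * t)) * -2) t := by
      simpa using ((hasDerivAt_id t).const_mul 2).neg.exp
    have h2 := (h.hasDerivAt t).rpow_const (p := p + 1) (Or.inr (by linarith))
    have h3 := ((h1.mul ((h.hasDerivAt' t).pow 2)).div_const 2).add
      ((h2.div_const (p + 1)).sub (((h.hasDerivAt t).pow 2).div_const 2))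
    refine h3.congr_deriv ?_
    have e1 : exp (-(2 * t)) * exp (2 * t) = 1 := by rw [← exp_add]; simp
    have e2 : p + 1 ≠ 0 := by linarith
    simp only [Pi.pow_apply, fNL, add_sub_cancel_right]
    push_cast
    field_simp
    linear_combination (-V t * (-W t + W t ^ p)) * e1
  · have : 0 ≤ (1 + c) * exp (-(2 * t)) * V t ^ 2 := by positivity
    linarith

/-- A positive solution which is eventually decreasing is bounded away from zero. -/
lemma exists_lower_bound (h : FowlerSol c p W V) (hc : 0 ≤ c) (hp : 1 < p) {T : ℝ}
    (hT : ∀ t > T, V t < 0) : ∃ m > 0, ∃ T', ∀ t ≥ T', m ≤ W t := by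
  have hanti := h.energy_antitone hc hp
  by_cases hneg : ∃ t₁, exp (-(2 * t₁)) * V t₁ ^ 2 / 2 +
      (W t₁ ^ (p + 1) / (p + 1) - W t₁ ^ 2 / 2) < 0
  · obtain ⟨t₁, h1⟩ := hneg
    set E := exp (-(2 * t₁)) * V t₁ ^ 2 / 2 + (W t₁ ^ (p + 1) / (p + 1) - W t₁ ^ 2 / 2)
    refine ⟨√(-2 * E), sqrt_pos.2 (by linarith), t₁, fun t ht => ?_⟩
    rw [sqrt_le_left (h.pos t).le]
    have h2 := hanti ht
    have h3 : 0 ≤ W t ^ (p + 1) / (p + 1) :=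
      div_nonneg (rpow_nonneg (h.pos t).le _) (by linarith)
    have h4 : 0 ≤ exp (-(2 * t)) * V t ^ 2 := by positivity
    change _ ≤ E at h2
    linarith
  · push Not at hneg
    by_cases hone : ∃ t₂ > T, W t₂ < 1
    · exfalso
      obtain ⟨t₂, ht₂, hW2⟩ := hone
      have hWanti : AntitoneOn W (Ioi T) := antitoneOn_of_hasDerivAt_nonpos (convex_Ioi T)
        (fun t _ => h.hasDerivAt t) fun t ht => (hT t ht).le
      have hk0 : 0 < 1 - 2 / (p + 1) := by
        rw [sub_pos, div_lt_one (by linarith)]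
        linarith
      set k := √(1 - 2 / (p + 1)) with hk
      have hk1 : k ^ 2 = 1 - 2 / (p + 1) := sq_sqrt hk0.le
      have hkpos : 0 < k := sqrt_pos.2 hk0
      have hV : ∀ t ≥ t₂, V t ≤ -(k * exp t * W t) := by
        intro t ht
        have htT : t ∈ Ioi T := lt_of_lt_of_le ht₂ ht
        have hW1 : W t ≤ 1 := (hWanti ht₂ htT ht).trans hW2.le
        have h1 := hneg t
        have h2 : W t ^ (p + 1) ≤ W t ^ 2 := by
          rw [← rpow_natCast]
          exact rpow_le_rpow_of_exponent_ge (h.pos t) hW1 (by push_cast; linarith)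
        have h3 : W t ^ (p + 1) / (p + 1) ≤ W t ^ 2 / (p + 1) :=
          div_le_div_of_nonneg_right h2 (by linarith)
        have h4 : k ^ 2 * W t ^ 2 ≤ exp (-(2 * t)) * V t ^ 2 := by
          rw [hk1]
          have : (1 - 2 / (p + 1)) * W t ^ 2 = W t ^ 2 - 2 * (W t ^ 2 / (p + 1)) := by ring
          linarith
        have h5 : (k * exp t * W t) ^ 2 ≤ (-V t) ^ 2 := by
          have e1 : exp (-(2 * t)) * exp t ^ 2 = 1 := by
            rw [← exp_nat_mul, ← exp_add]; simp
          have h6 := mul_le_mul_of_nonneg_left h4 (sq_nonneg (exp t))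
          calc (k * exp t * W t) ^ 2 = exp t ^ 2 * (k ^ 2 * W t ^ 2) := by ring
            _ ≤ _ := h6
            _ = (exp (-(2 * t)) * exp t ^ 2) * V t ^ 2 := by ring
            _ = _ := by rw [e1]; ring
        have := abs_le_of_sq_le_sq h5 (by linarith [hT t htT])
        linarith [(le_abs_self _).trans this]
      have hdec : AntitoneOn (fun t => W t * exp (k * exp t)) (Ici t₂) := by
        refine antitoneOn_of_hasDerivAt_nonpos (convex_Ici t₂)
          (f' := fun t => (V t + k * exp t * W t) * exp (k * exp t)) (fun t _ => ?_) fun t ht => ?_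
        · exact ((h.hasDerivAt t).mul ((hasDerivAt_exp t).const_mul k).exp).congr_deriv (by ring)
        · exact mul_nonpos_of_nonpos_of_nonneg (by linarith [hV t ht]) (exp_pos _).le
      obtain ⟨t, ht, hlt⟩ := h.not_decay k hkpos (W t₂ * exp (k * exp t₂)) t₂
      have h1 := hdec self_mem_Ici ht ht
      simp only at h1
      have h2 := mul_le_mul_of_nonneg_right h1 (exp_pos (-(k * exp t))).le
      rw [mul_assoc, ← exp_add, add_neg_cancel, exp_zero, mul_one] at h2
      linarith
    · push Not at hone
      exact ⟨1, one_pos, T + 1, fun t ht => hone t (by linarith)⟩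

lemma exists_zero_of_lower_bound (h : FowlerSol c p W V) (hp : 1 < p) {m T : ℝ} (hm : 0 < m)
    (hW : ∀ t ≥ T, m ≤ W t) : ∃ T', ∀ t₁ ≥ T', ∃ t ∈ Icc t₁ (t₁ + 7), W t = 1 := by
  set μ := min 1 (p - 1) * min m 1 with hμ
  have hμ0 : 0 < μ := mul_pos (lt_min one_pos (by linarith)) (lt_min hm one_pos)
  have hlim : Tendsto (fun t : ℝ => exp (2 * t) * μ) atTop atTop :=
    (tendsto_exp_atTop.comp (tendsto_id.const_mul_atTop two_pos)).atTop_mul_const hμ0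
  obtain ⟨T₁, hT₁⟩ := eventually_atTop.1 (hlim.eventually_ge_atTop (c ^ 2 / 2 + 1 / 2))
  refine ⟨max T T₁, fun t₁ ht₁ => ?_⟩
  obtain ⟨t, ht, h0⟩ := exists_zero_of_large_potential (c := c) (t₁ := t₁) (x := fun t => W t - 1)
    (v := V) (q := fun t => exp (2 * t) * (fNL p (W t) / (W t - 1)))
    (fun t _ => (h.hasDerivAt t).sub_const 1)
    (fun t _ h0 => (h.hasDerivAt' t).congr_deriv (by field_simp))
    (fun t ht h0 => by
      have ht1 : max T T₁ ≤ t := ht₁.le.trans ht.1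
      refine (hT₁ t ((le_max_right _ _).trans ht1)).trans ?_
      refine mul_le_mul_of_nonneg_left ?_ (exp_pos _).le
      have h1 := fNL_mul_sub_one_ge hp (h.pos t)
      have h2 : 0 < (W t - 1) ^ 2 := by positivity
      have h3 : fNL p (W t) / (W t - 1) = fNL p (W t) * (W t - 1) / (W t - 1) ^ 2 := by field_simp
      rw [h3, le_div_iff₀ h2]
      refine le_trans ?_ h1
      refine mul_le_mul_of_nonneg_right ?_ h2.le
      exact mul_le_mul_of_nonneg_left (min_le_min_right _ (hW t ((le_max_left _ _).trans ht1)))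
        (le_min zero_le_one (by linarith)))
  exact ⟨t, ht, by linarith⟩

lemma exists_criticalPt_gt (h : FowlerSol c p W V) (hc : 0 ≤ c) (hp : 1 < p) (T : ℝ) :
    ∃ t > T, V t = 0 := by
  by_contra! hne
  have hlow : ∃ m > 0, ∃ T', ∀ t ≥ T', m ≤ W t := by
    rcases pos_or_neg_of_ne_zero isPreconnected_Ioi h.continuous'.continuousOn hne
      with hV | hV
    · refine ⟨W (T + 1), h.pos _, T + 1, fun t ht => ?_⟩
      exact monotoneOn_of_hasDerivAt_nonneg (convex_Ioi T) (fun t _ => h.hasDerivAt t)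
        (fun t ht => (hV t ht).le) (show T < T + 1 by linarith) (show T < t by linarith) ht
    · exact h.exists_lower_bound hc hp hV
  obtain ⟨m, hm, T', hT'⟩ := hlow
  obtain ⟨T₁, hT₁⟩ := h.exists_zero_of_lower_bound hp hm hT'
  obtain ⟨z₁, hz₁, h1⟩ := hT₁ (max T₁ (T + 1)) (le_max_left _ _)
  obtain ⟨z₂, hz₂, h2⟩ := hT₁ (z₁ + 1) (by linarith [hz₁.1, le_max_left T₁ (T + 1)])
  obtain ⟨ξ, hξ, h0⟩ := exists_hasDerivAt_eq_zero (show z₁ < z₂ by linarith [hz₂.1])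
    h.continuous.continuousOn (h1.trans h2.symm) fun t _ => h.hasDerivAt t
  exact hne ξ (show T < ξ by linarith [hξ.1, hz₁.1, le_max_right T₁ (T + 1)]) h0

end FowlerSol

lemma nonneg_of_mul_sub_nonneg {f : ℝ → ℝ} {d σ : ℝ} {l : Filter ℝ} [l.NeBot]
    (hl : l ≤ 𝓝[≠] σ) (hf : HasDerivAt f d σ) (h0 : f σ = 0)
    (h : ∀ᶠ t in l, 0 ≤ f t * (t - σ)) : 0 ≤ d := by
  refine ge_of_tendsto ((hasDerivAt_iff_tendsto_slope.1 hf).mono_left hl) ?_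
  filter_upwards [h] with t ht
  rw [slope_def_field, h0, sub_zero]
  rcases eq_or_ne (t - σ) 0 with e | e
  · simp [e]
  · have : f t / (t - σ) = f t * (t - σ) / (t - σ) ^ 2 := by field_simp
    rw [this]
    positivity

namespace FowlerSol

variable {c p : ℝ} {W V : ℝ → ℝ}

lemma lt_one_of_mul_sub_nonneg (h : FowlerSol c p W V) (hc : 0 ≤ c) (hp : 1 < p) {τ : ℝ}
    (hτ : V τ = 0) {l : Filter ℝ} [l.NeBot] (hl : l ≤ 𝓝[≠] τ)
    (hV : ∀ᶠ t in l, 0 ≤ V t * (t - τ)) : W τ < 1 := by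
  have h1 := nonneg_of_mul_sub_nonneg hl (h.hasDerivAt' τ) hτ hV
  rw [hτ, mul_zero, zero_sub, neg_nonneg] at h1
  have h2 := nonpos_of_mul_nonpos_right h1 (exp_pos _)
  refine lt_of_le_of_ne ?_ (h.ne_one hc hp hτ)
  by_contra! h3
  have h4 := fNL_mul_sub_one_ge hp (h.pos τ)
  have h5 : 0 < min 1 (p - 1) * min (W τ) 1 * (W τ - 1) ^ 2 :=
    mul_pos (mul_pos (lt_min one_pos (by linarith)) (lt_min (h.pos τ) one_pos))
      (pow_pos (by linarith) 2)
  nlinarith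

lemma one_lt_of_mul_sub_nonpos (h : FowlerSol c p W V) (hc : 0 ≤ c) (hp : 1 < p) {τ : ℝ}
    (hτ : V τ = 0) {l : Filter ℝ} [l.NeBot] (hl : l ≤ 𝓝[≠] τ)
    (hV : ∀ᶠ t in l, V t * (t - τ) ≤ 0) : 1 < W τ := by
  have h1 := nonneg_of_mul_sub_nonneg hl (h.hasDerivAt' τ).neg (by simp [hτ])
    (hV.mono fun t ht => by simp only [Pi.neg_apply]; linarith)
  rw [hτ, mul_zero, zero_sub, neg_neg] at h1
  have h2 := nonneg_of_mul_nonneg_right h1 (exp_pos _)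
  refine lt_of_le_of_ne ?_ (h.ne_one hc hp hτ).symm
  by_contra! h3
  have h4 := fNL_mul_sub_one_ge hp (h.pos τ)
  have h5 : 0 < min 1 (p - 1) * min (W τ) 1 * (W τ - 1) ^ 2 :=
    mul_pos (mul_pos (lt_min one_pos (by linarith)) (lt_min (h.pos τ) one_pos))
      (even_two.pow_pos (sub_neg.2 h3).ne)
  nlinarith

lemma injOn_of_ne_zero (h : FowlerSol c p W V) {s : Set ℝ} (hs : s.OrdConnected)
    (hV : ∀ t ∈ interior s, V t ≠ 0) : InjOn W s := by
  have key : ∀ x ∈ s, ∀ y ∈ s, x < y → W x ≠ W y := by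
    intro x hx y hy hxy he
    obtain ⟨ξ, hξ, h0⟩ := exists_hasDerivAt_eq_zero hxy h.continuous.continuousOn he
      fun t _ => h.hasDerivAt t
    refine hV ξ ?_ h0
    exact interior_mono (hs.out hx hy) (by rwa [interior_Icc])
  intro x hx y hy he
  by_contra hne
  rcases lt_or_gt_of_ne hne with h1 | h1
  · exact key x hx y hy h1 he
  · exact key y hy x hx h1 he.symm

/-- Between consecutive critical points the solution crosses `1` exactly once. -/
lemma exists_crossing (h : FowlerSol c p W V) (hc : 0 ≤ c) (hp : 1 < p) {σ τ : ℝ}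
    (hστ : σ < τ) (hσ : V σ = 0) (hτ : V τ = 0) (hV : ∀ t ∈ Ioo σ τ, V t ≠ 0) :
    ∃ z ∈ Ioo σ τ, W z = 1 ∧ ∀ t ∈ Icc σ τ, W t = 1 → t = z := by
  have hinj : InjOn W (Icc σ τ) := h.injOn_of_ne_zero ordConnected_Icc (by rwa [interior_Icc])
  have hl : 𝓝[>] σ ≤ 𝓝[≠] σ := nhdsGT_le_nhdsNE σ
  have hr : 𝓝[<] τ ≤ 𝓝[≠] τ := nhdsLT_le_nhdsNE τ
  have hml : ∀ᶠ t in 𝓝[>] σ, t ∈ Ioo σ τ := Ioo_mem_nhdsGT hστ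
  have hmr : ∀ᶠ t in 𝓝[<] τ, t ∈ Ioo σ τ := Ioo_mem_nhdsLT hστ
  have hz : ∃ z ∈ Ioo σ τ, W z = 1 := by
    rcases pos_or_neg_of_ne_zero isPreconnected_Ioo h.continuous'.continuousOn hV with hV | hV
    · refine intermediate_value_Ioo hστ.le h.continuous.continuousOn
        ⟨h.lt_one_of_mul_sub_nonneg hc hp hσ hl ?_, h.one_lt_of_mul_sub_nonpos hc hp hτ hr ?_⟩
      · exact hml.mono fun t ht => mul_nonneg (hV t ht).le (by linarith [ht.1])
      · exact hmr.mono fun t ht =>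
          mul_nonpos_of_nonneg_of_nonpos (hV t ht).le (by linarith [ht.2])
    · refine intermediate_value_Ioo' hστ.le h.continuous.continuousOn
        ⟨h.lt_one_of_mul_sub_nonneg hc hp hτ hr ?_, h.one_lt_of_mul_sub_nonpos hc hp hσ hl ?_⟩
      · exact hmr.mono fun t ht => mul_nonneg_of_nonpos_of_nonpos (hV t ht).le (by linarith [ht.2])
      · exact hml.mono fun t ht =>
          mul_nonpos_of_nonpos_of_nonneg (hV t ht).le (by linarith [ht.1])
  obtain ⟨z, hz, hz1⟩ := hz
  exact ⟨z, hz, hz1, fun t ht h1 => hinj ht (Ioo_subset_Icc_self hz) (h1.trans hz1.symm)⟩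

lemma exists_next_criticalPt (h : FowlerSol c p W V) (hc : 0 ≤ c) (hp : 1 < p) {σ : ℝ}
    (hσ : V σ = 0) : ∃ τ, IsLeast {t | σ < t ∧ V t = 0} τ := by
  obtain ⟨u, hu, hsub⟩ := mem_nhdsGT_iff_exists_Ioo_subset.1
    ((h.isolated hc hp hσ).filter_mono (nhdsGT_le_nhdsNE σ))
  have e : {t | σ < t ∧ V t = 0} = Ici u ∩ V ⁻¹' {0} := by
    ext t
    refine ⟨fun ht => ⟨?_, ht.2⟩, fun ht => ⟨lt_of_lt_of_le hu ht.1, ht.2⟩⟩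
    by_contra hlt
    exact hsub ⟨ht.1, not_le.1 hlt⟩ ht.2
  obtain ⟨t, ht⟩ := h.exists_criticalPt_gt hc hp σ
  have hne : {t | σ < t ∧ V t = 0}.Nonempty := ⟨t, ht⟩
  have hbdd : BddBelow {t | σ < t ∧ V t = 0} := ⟨σ, fun t ht => ht.1.le⟩
  rw [e] at hne hbdd ⊢
  exact ⟨_, (isClosed_Ici.inter (isClosed_singleton.preimage h.continuous')).isLeast_csInf hne hbdd⟩

lemma exists_first_criticalPt (h : FowlerSol c p W V) (hc : 0 ≤ c) (hp : 1 < p) :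
    ∃ τ, IsLeast {t | V t = 0} τ := by
  obtain ⟨s, hs⟩ := eventually_atBot.1 h.eventually_neg
  obtain ⟨t, -, ht⟩ := h.exists_criticalPt_gt hc hp 0
  refine ⟨_, (isClosed_singleton.preimage h.continuous' :
    IsClosed (V ⁻¹' {0})).isLeast_csInf ⟨t, ht⟩ ⟨s, fun t ht => ?_⟩⟩
  by_contra hlt
  exact (hs t (not_le.1 hlt).le).ne ht

lemma exists_first_crossing (h : FowlerSol c p W V) (hc : 0 ≤ c) (hp : 1 < p) {τ : ℝ}
    (hτ : IsLeast {t | V t = 0} τ) : ∃ z, {t | t ≤ τ ∧ W t = 1} = {z} := by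
  have hV : ∀ t ∈ Iio τ, V t ≠ 0 := fun t ht h0 => absurd (hτ.2 h0) (not_le.2 ht)
  have hinj : InjOn W (Iic τ) := h.injOn_of_ne_zero ordConnected_Iic (by rwa [interior_Iic])
  have hneg : ∀ t ∈ Iio τ, V t < 0 := by
    rcases pos_or_neg_of_ne_zero isPreconnected_Iio h.continuous'.continuousOn hV with hV | hV
    · obtain ⟨s, hs, hsτ⟩ := (h.eventually_neg.and (eventually_lt_atBot τ)).exists
      exact absurd (hV s hsτ) (not_lt.2 hs.le)
    · exact hV
  have hW : W τ < 1 := h.lt_one_of_mul_sub_nonneg hc hp hτ.1 (nhdsLT_le_nhdsNE τ)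
    (by filter_upwards [self_mem_nhdsWithin] with t ht using
      mul_nonneg_of_nonpos_of_nonpos (hneg t ht).le (by linarith [show t < τ from ht]))
  obtain ⟨s, hs, hsτ⟩ := ((h.tendsto.eventually_gt_atTop 1).and (eventually_le_atBot τ)).exists
  obtain ⟨z, hz, hz1⟩ := intermediate_value_Icc' hsτ h.continuous.continuousOn ⟨hW.le, hs.le⟩
  refine ⟨z, ?_⟩
  ext t
  refine ⟨fun ht => hinj ht.1 hz.2 (ht.2.trans hz1.symm), ?_⟩
  rintro rfl
  exact ⟨hz.2, hz1⟩

/-- The critical points form an increasing divergent sequence and the `k`-th one is preceded by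
exactly `k + 1` crossings of `1`. -/
lemma exists_criticalPt_seq (h : FowlerSol c p W V) (hc : 0 ≤ c) (hp : 1 < p) :
    ∃ τ : ℕ → ℝ, StrictMono τ ∧ Tendsto τ atTop atTop ∧ (∀ k, V (τ k) = 0) ∧
      (∀ k, {t | t ≤ τ k ∧ W t = 1}.encard = (k : ℕ∞) + 1) ∧ ∀ σ, V σ = 0 → ∃ k, σ = τ k := by
  obtain ⟨τ₀, hτ₀⟩ := h.exists_first_criticalPt hc hp
  choose next hnext using fun x : {t // V t = 0} => h.exists_next_criticalPt hc hp x.2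
  set x : ℕ → {t // V t = 0} := fun k =>
    Nat.rec ⟨τ₀, hτ₀.1⟩ (fun _ y => ⟨next y, (hnext y).1.2⟩) k with hx
  have hleast : ∀ k, IsLeast {t | (x k : ℝ) < t ∧ V t = 0} (x (k + 1)) := fun k => hnext (x k)
  have hmono : StrictMono fun k => (x k : ℝ) := strictMono_nat_of_lt_succ fun k => (hleast k).1.1
  have htend : Tendsto (fun k => (x k : ℝ)) atTop atTop := by
    rcases tendsto_atTop_of_monotone hmono.monotone with ht | ⟨L, hL⟩
    · exact ht
    exfalso
    have hVL : V L = 0 := tendsto_nhds_unique ((h.continuous'.tendsto L).comp hL)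
      (by simp [Function.comp_def, fun k => (x k).2])
    have hlt : ∀ k, (x k : ℝ) < L := fun k =>
      (hmono (Nat.lt_succ_self k)).trans_le (hmono.monotone.ge_of_tendsto hL (k + 1))
    obtain ⟨k, hk⟩ := ((tendsto_nhdsWithin_iff.2
      ⟨hL, Eventually.of_forall fun k => (hlt k).ne⟩).eventually (h.isolated hc hp hVL)).exists
    exact hk (x k).2
  refine ⟨fun k => x k, hmono, htend, fun k => (x k).2, fun k => ?_, fun σ hσ => ?_⟩
  · induction k with
    | zero =>
      obtain ⟨z, hz⟩ := h.exists_first_crossing hc hp hτ₀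
      change {t | t ≤ τ₀ ∧ W t = 1}.encard = _
      rw [hz, encard_singleton]
      simp
    | succ k ih =>
      have hlt := hmono (Nat.lt_succ_self k)
      obtain ⟨z, hz, hz1, huniq⟩ := h.exists_crossing hc hp hlt (x k).2 (x (k + 1)).2
        fun t ht h0 => absurd ((hleast k).2 ⟨ht.1, h0⟩) (not_le.2 ht.2)
      have e : {t | t ≤ (x (k + 1) : ℝ) ∧ W t = 1} = insert z {t | t ≤ (x k : ℝ) ∧ W t = 1} := by
        ext t
        constructor
        · intro ht
          rcases le_or_gt t (x k) with h1 | h1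
          · exact Or.inr ⟨h1, ht.2⟩
          · exact Or.inl (huniq t ⟨h1.le, ht.1⟩ ht.2)
        · rintro (rfl | ht)
          · exact ⟨hz.2.le, hz1⟩
          · exact ⟨ht.1.trans hlt.le, ht.2⟩
      rw [e, encard_insert_of_notMem fun hmem => absurd hmem.1 (not_le.2 hz.1), ih]
      push_cast
      rfl
  · have hex : ∃ k, σ ≤ x k := (htend.eventually_ge_atTop σ).exists
    classical
    refine ⟨Nat.find hex, le_antisymm (Nat.find_spec hex) ?_⟩
    rcases hk : Nat.find hex with _ | k
    · exact hτ₀.2 hσ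
    · exact (hleast k).2 ⟨not_le.1 (Nat.find_min hex (hk ▸ Nat.lt_succ_self k)), hσ⟩

end FowlerSol

/-! ### Passing between the two formulations -/

/-- Relations between the constants of the Emden-Fowler substitution. -/
structure FowlerParams (a c κ θ A p : ℝ) : Prop where
  one_lt : 1 < p
  a_pos : 0 < a
  θ_pos : 0 < θ
  κ_pos : 0 < κ
  A_pos : 0 < A
  θ_mul : θ * (p - 1) = 2
  c_eq : c = a + 2 * θ
  κ_eq : κ = θ * (c - θ)
  A_rpow : A ^ (p - 1) = κ

namespace FowlerParams

variable {a c κ θ A p : ℝ} {y v : ℝ → ℝ}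

lemma exp_mul_rpow (h : FowlerParams a c κ θ A p) {x : ℝ} (hx : 0 < x) (t : ℝ) :
    exp (2 * t) * (A * exp (-(θ * t)) * x) ^ p = A * exp (-(θ * t)) * (κ * x ^ p) := by
  have hA : A ^ p = A * κ := by
    rw [← h.A_rpow, ← rpow_one_add' h.A_pos.le (by linarith [h.one_lt]), add_sub_cancel]
  have he : exp (2 * t) * exp (-(θ * t) * p) = exp (-(θ * t)) := by
    rw [← exp_add]
    congr 1
    linear_combination (-t) * h.θ_mul
  rw [mul_rpow (mul_pos h.A_pos (exp_pos _)).le hx.le, mul_rpow h.A_pos.le (exp_pos _).le, hA,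
    ← exp_mul]
  linear_combination (A * κ * x ^ p) * he

lemma not_decay (h : FowlerParams a c κ θ A p) (hpos : ∀ t, 0 < y t)
    (hen : ∀ t, efEnergy κ p t (y t) (v t) ≤ efMin κ p) {k : ℝ} (hk : 0 < k) (C T : ℝ) :
    ∃ t ≥ T, C * exp (-(k * exp t)) < A * exp (-(θ * t)) * y t := by
  by_contra! hdec
  have hneg := efMin_neg h.κ_pos h.one_lt
  have hlow : ∀ t, -2 * efMin κ p ≤ (κ + exp (2 * t)) * y t ^ 2 := by
    intro t
    have h1 := hen t
    have h2 : 0 ≤ κ * (y t ^ (p + 1) / (p + 1)) :=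
      mul_nonneg h.κ_pos.le (div_nonneg (rpow_nonneg (hpos t).le _) (by linarith [h.one_lt]))
    unfold efEnergy at h1
    linarith [sq_nonneg (v t)]
  have hlim : Tendsto (fun s : ℝ => (C / A) ^ 2 * (κ * (s ^ (2 * θ) * exp (-(2 * k) * s)) +
      s ^ (2 * θ + 2) * exp (-(2 * k) * s))) atTop (𝓝 0) := by
    have h1 := tendsto_rpow_mul_exp_neg_mul_atTop_nhds_zero (2 * θ) (2 * k) (by linarith)
    have h2 := tendsto_rpow_mul_exp_neg_mul_atTop_nhds_zero (2 * θ + 2) (2 * k) (by linarith)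
    simpa using ((h1.const_mul κ).add h2).const_mul ((C / A) ^ 2)
  obtain ⟨t, ht, htT⟩ := (((hlim.comp tendsto_exp_atTop).eventually_lt_const
    (show 0 < -2 * efMin κ p by linarith)).and (eventually_ge_atTop T)).exists
  refine absurd ((hlow t).trans ?_) (not_le.2 ht)
  have hy : y t ≤ C / A * (exp (θ * t) * exp (-(k * exp t))) := by
    have h1 := hdec t htT
    have h2 : exp (θ * t) * exp (-(θ * t)) = 1 := by rw [← exp_add]; simp
    have h3 := mul_le_mul_of_nonneg_left h1 (exp_pos (θ * t)).le
    have h4 : exp (θ * t) * (A * exp (-(θ * t)) * y t) = A * y t := by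
      linear_combination (A * y t) * h2
    rw [h4] at h3
    rw [div_mul_eq_mul_div, le_div_iff₀ h.A_pos]
    linarith
  have hy2 := pow_le_pow_left₀ (hpos t).le hy 2
  have e1 : exp t ^ (2 * θ) = exp (θ * t) ^ 2 := by
    rw [← exp_mul, ← exp_nat_mul]; congr 1; push_cast; ring
  have e2 : exp t ^ (2 * θ + 2) = exp (θ * t) ^ 2 * exp (2 * t) := by
    rw [← exp_mul, ← exp_nat_mul, ← exp_add]; congr 1; push_cast; ring
  have e3 : exp (-(2 * k) * exp t) = exp (-(k * exp t)) ^ 2 := by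
    rw [← exp_nat_mul]; congr 1; push_cast; ring
  have hκ : 0 ≤ κ + exp (2 * t) := add_nonneg h.κ_pos.le (exp_pos _).le
  refine (mul_le_mul_of_nonneg_left hy2 hκ).trans_eq ?_
  simp only [Function.comp_apply, e1, e2, e3]
  ring

lemma abs_deriv_le (h : FowlerParams a c κ θ A p) {t : ℝ} (hpos : 0 < y t)
    (hen : efEnergy κ p t (y t) (v t) ≤ efMin κ p) : |v t| ≤ exp t * y t := by
  have h1 := mul_nonneg h.κ_pos.le (potential_nonneg h.one_lt hpos.le)
  refine abs_le_of_sq_le_sq ?_ (mul_pos (exp_pos _) hpos).le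
  have e : exp (2 * t) = exp t ^ 2 := by rw [← exp_nat_mul]; simp
  unfold efEnergy efMin at hen
  rw [mul_pow, ← e]
  linarith

lemma fowlerSol (h : FowlerParams a c κ θ A p) (hsol : ∀ b, EFSol a κ p b y v)
    (hen : ∀ t, efEnergy κ p t (y t) (v t) ≤ efMin κ p) :
    FowlerSol c p (fun t => A * exp (-(θ * t)) * y t)
      (fun t => A * exp (-(θ * t)) * (v t - θ * y t)) := by
  have hpos : ∀ t, 0 < y t := fun t => (hsol (t + 1)).pos t (by linarith)
  have hy : ∀ t, HasDerivAt y (v t) t := fun t => (hsol (t + 1)).hasDerivAt t (by linarith)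
  have hv := fun t => (hsol (t + 1)).hasDerivAt' t (by linarith)
  have hexp : ∀ t, HasDerivAt (fun t => A * exp (-(θ * t))) (A * exp (-(θ * t)) * -θ) t := by
    intro t
    refine ((((hasDerivAt_id t).const_mul θ).neg.exp).const_mul A).congr_deriv ?_
    simp only [id, mul_one, Pi.neg_apply]
    ring
  refine ⟨fun t => ?_, fun t => ?_, fun t => mul_pos (mul_pos h.A_pos (exp_pos _)) (hpos t),
    ?_, ?_, fun k hk C T => h.not_decay hpos hen hk C T⟩
  · exact ((hexp t).mul (hy t)).congr_deriv (by ring)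
  · refine ((hexp t).mul ((hv t).sub ((hy t).const_mul θ))).congr_deriv ?_
    have e := h.exp_mul_rpow (hpos t) t
    rw [fNL, mul_add, e, h.κ_eq, h.c_eq]
    simp only [Pi.sub_apply]
    ring
  · have h1 : Tendsto (fun t : ℝ => A * exp (-(θ * t))) atBot atTop :=
      (tendsto_exp_atTop.comp (tendsto_neg_atBot_atTop.comp
        (tendsto_id.const_mul_atBot h.θ_pos))).const_mul_atTop h.A_pos
    exact h1.atTop_mul_pos one_pos (hsol 0).tendsto
  · filter_upwards [tendsto_exp_atBot.eventually_lt_const h.θ_pos] with t ht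
    refine mul_neg_of_pos_of_neg (mul_pos h.A_pos (exp_pos _)) ?_
    have h1 := (le_abs_self _).trans (h.abs_deriv_le (hpos t) (hen t))
    have h2 := mul_lt_mul_of_pos_right ht (hpos t)
    linarith

/-- The singular Neumann-type equation on `(0, 1)` in Emden-Fowler variables. -/
lemma efSol_of_radial (h : FowlerParams a c κ θ A p) {τ : ℝ} {U U' U'' : ℝ → ℝ}
    (hU : ∀ r ∈ Ioo (0 : ℝ) 1, HasDerivAt U (U' r) r)
    (hU' : ∀ r ∈ Ioo (0 : ℝ) 1, HasDerivAt U' (U'' r) r)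
    (heq : ∀ r ∈ Ioo (0 : ℝ) 1, U'' r + (c + 1) / r * U' r + exp (2 * τ) * fNL p (U r) = 0)
    (hpos : ∀ r ∈ Ioo (0 : ℝ) 1, 0 < U r)
    (hlim : Tendsto (fun r => r ^ θ * U r) (𝓝[>] 0) (𝓝 (A * exp (-(θ * τ))))) :
    EFSol a κ p τ (fun t => A⁻¹ * exp (θ * t) * U (exp (t - τ)))
      (fun t => A⁻¹ * exp (θ * t) * (θ * U (exp (t - τ)) + exp (t - τ) * U' (exp (t - τ)))) := by
  have hA := h.A_pos.ne'
  have hmem : ∀ t < τ, exp (t - τ) ∈ Ioo (0 : ℝ) 1 := fun t ht =>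
    ⟨exp_pos _, exp_lt_one_iff.2 (by linarith)⟩
  have hexp : ∀ t, HasDerivAt (fun t => A⁻¹ * exp (θ * t)) (A⁻¹ * exp (θ * t) * θ) t := by
    intro t
    refine (((hasDerivAt_id t).const_mul θ).exp.const_mul A⁻¹).congr_deriv ?_
    simp only [id, mul_one]
    ring
  have hr : ∀ t, HasDerivAt (fun t => exp (t - τ)) (exp (t - τ)) t := fun t => by
    simpa using ((hasDerivAt_id t).sub_const τ).exp
  have hUc : ∀ t < τ, HasDerivAt (fun t => U (exp (t - τ))) (U' (exp (t - τ)) * exp (t - τ)) t :=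
    fun t ht => (hU _ (hmem t ht)).comp t (hr t)
  have hU'c : ∀ t < τ,
      HasDerivAt (fun t => U' (exp (t - τ))) (U'' (exp (t - τ)) * exp (t - τ)) t :=
    fun t ht => (hU' _ (hmem t ht)).comp t (hr t)
  have hy : ∀ t < τ, 0 < A⁻¹ * exp (θ * t) * U (exp (t - τ)) := fun t ht =>
    mul_pos (mul_pos (inv_pos.2 h.A_pos) (exp_pos _)) (hpos _ (hmem t ht))
  refine ⟨fun t ht => ?_, fun t ht => ?_, hy, ?_⟩
  · exact ((hexp t).mul (hUc t ht)).congr_deriv (by ring)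
  · refine ((hexp t).mul (((hUc t ht).const_mul θ).add
      ((hr t).mul (hU'c t ht)))).congr_deriv ?_
    have e1 := heq _ (hmem t ht)
    have e2 := h.exp_mul_rpow (hy t ht) t
    have e3 : exp (-(θ * t)) * exp (θ * t) = 1 := by rw [← exp_add]; simp
    have e4 : A * exp (-(θ * t)) * (A⁻¹ * exp (θ * t) * U (exp (t - τ))) = U (exp (t - τ)) := by
      linear_combination U (exp (t - τ)) * e3 + (exp (-(θ * t)) * exp (θ * t) * U (exp (t - τ))) *
        mul_inv_cancel₀ hA
    have e5 : exp (2 * τ) * exp (t - τ) ^ 2 = exp (2 * t) := by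
      rw [← exp_nat_mul, ← exp_add]; congr 1; push_cast; ring
    rw [e4] at e2
    set Y := A⁻¹ * exp (θ * t) * U (exp (t - τ)) with hY
    set r := exp (t - τ) with hr_def
    have hr0 : r ≠ 0 := (exp_pos _).ne'
    have e6 : A⁻¹ * exp (θ * t) * (exp (2 * t) * U r ^ p) = κ * Y ^ p := by
      rw [e2]
      linear_combination (κ * Y ^ p) * e3 + (exp (-(θ * t)) * exp (θ * t) * (κ * Y ^ p)) *
        mul_inv_cancel₀ hA
    have e7 : r ^ 2 * U'' r = -((c + 1) * r * U' r) - exp (2 * t) * (-U r + U r ^ p) := by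
      rw [← e5]
      unfold fNL at e1
      field_simp at e1
      linear_combination r * e1
    simp only [Pi.add_apply, Pi.mul_apply]
    linear_combination A⁻¹ * exp (θ * t) * e7 - e6 - (A⁻¹ * exp (θ * t)) *
      (θ * U r + r * U' r) * h.c_eq - (A⁻¹ * exp (θ * t) * U r) * h.κ_eq -
      (κ + exp (2 * t)) * hY
  · have h1 : Tendsto (fun t => exp (t - τ)) atBot (𝓝[>] 0) :=
      tendsto_nhdsWithin_iff.2 ⟨tendsto_exp_atBot.comp (tendsto_atBot_add_const_right _ _ tendsto_id),
        Eventually.of_forall fun t => exp_pos _⟩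
    have h2 := (hlim.comp h1).const_mul (A⁻¹ * exp (θ * τ))
    have e1 : A⁻¹ * exp (θ * τ) * (A * exp (-(θ * τ))) = 1 := by
      have e3 : exp (-(θ * τ)) * exp (θ * τ) = 1 := by rw [← exp_add]; simp
      linear_combination e3 + (exp (-(θ * τ)) * exp (θ * τ)) * mul_inv_cancel₀ hA
    rw [e1] at h2
    refine h2.congr fun t => ?_
    have e2 : exp (θ * τ) * exp (t - τ) ^ θ = exp (θ * t) := by
      rw [← exp_mul, ← exp_add]; congr 1; ring
    simp only [Function.comp_apply]
    rw [← e2]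
    ring

end FowlerParams

namespace FowlerSol

variable {c p : ℝ} {W V : ℝ → ℝ}

lemma hasDerivAt_radial (h : FowlerSol c p W V) (τ : ℝ) {r : ℝ} (hr : 0 < r) :
    HasDerivAt (fun r => W (τ + log r)) (V (τ + log r) / r) r :=
  (h.hasDerivAt _).comp r ((hasDerivAt_log hr.ne').const_add τ)

lemma hasDerivAt_radial' (h : FowlerSol c p W V) (τ : ℝ) {r : ℝ} (hr : 0 < r) :
    HasDerivAt (fun r => V (τ + log r) / r)
      (-((c + 1) / r * (V (τ + log r) / r)) - exp (2 * τ) * fNL p (W (τ + log r))) r := by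
  have h1 := ((h.hasDerivAt' _).comp r ((hasDerivAt_log hr.ne').const_add τ)).div
    (hasDerivAt_id r) hr.ne'
  refine h1.congr_deriv ?_
  have e : exp (2 * (τ + log r)) = exp (2 * τ) * r ^ 2 := by
    rw [mul_add, exp_add, two_mul (log r), exp_add, exp_log hr, sq]
  simp only [e, id, Function.comp_apply]
  field_simp
  ring

lemma encard_radial (W : ℝ → ℝ) (τ : ℝ) :
    {r ∈ Ioc (0 : ℝ) 1 | W (τ + log r) = 1}.encard = {t | t ≤ τ ∧ W t = 1}.encard := by
  have hinj : Function.Injective fun t => exp (t - τ) := fun s t hst => by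
    simpa using exp_injective hst
  rw [← hinj.encard_image {t | t ≤ τ ∧ W t = 1}]
  congr 1
  ext r
  constructor
  · rintro ⟨hr, h1⟩
    refine ⟨τ + log r, ⟨by linarith [log_nonpos hr.1.le hr.2], h1⟩, ?_⟩
    simp [exp_log hr.1]
  · rintro ⟨t, ⟨ht, h1⟩, rfl⟩
    refine ⟨⟨exp_pos _, exp_le_one_iff.2 (by linarith)⟩, ?_⟩
    simpa using h1

end FowlerSol

lemma exp_neg_mul_add_log (θ τ : ℝ) {r : ℝ} (hr : 0 < r) :
    exp (-(θ * (τ + log r))) = exp (-(θ * τ)) * r ^ (-θ) := by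
  rw [rpow_def_of_pos hr, ← exp_add]
  congr 1
  ring

lemma tendsto_rpow_mul_profile {y : ℝ → ℝ} (hlim : Tendsto y atBot (𝓝 1)) (A θ τ : ℝ) :
    Tendsto (fun r => r ^ θ * (A * exp (-(θ * (τ + log r))) * y (τ + log r))) (𝓝[>] 0)
      (𝓝 (A * exp (-(θ * τ)))) := by
  have h1 : Tendsto (fun r => τ + log r) (𝓝[>] 0) atBot :=
    tendsto_atBot_add_const_left _ _ tendsto_log_nhdsGT_zero
  have h2 := (hlim.comp h1).const_mul (A * exp (-(θ * τ)))
  rw [mul_one] at h2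
  refine h2.congr' ?_
  filter_upwards [self_mem_nhdsWithin] with r hr
  have e : r ^ θ * r ^ (-θ) = 1 := by rw [← rpow_add hr, add_neg_cancel, rpow_zero]
  rw [exp_neg_mul_add_log θ τ hr]
  simp only [Function.comp_apply]
  linear_combination (-(A * exp (-(θ * τ)) * y (τ + log r))) * e

namespace FowlerParams

variable {a c κ θ A p : ℝ} {y v : ℝ → ℝ}

lemma integrableOn_radial (h : FowlerParams a c κ θ A p) {N : ℕ} (hN : 1 ≤ N) (hc : c = N - 2)
    (hsol : ∀ b, EFSol a κ p b y v) (hen : ∀ t, efEnergy κ p t (y t) (v t) ≤ efMin κ p) (τ : ℝ) :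
    IntegrableOn (fun r => ((A * exp (-(θ * (τ + log r))) * y (τ + log r)) ^ 2 +
      (A * exp (-(θ * (τ + log r))) * (v (τ + log r) - θ * y (τ + log r)) / r) ^ 2) *
        r ^ (N - 1)) (Ioo 0 1) := by
  have hfow := h.fowlerSol hsol hen
  have hpos : ∀ t, 0 < y t := fun t => (hsol (t + 1)).pos t (by linarith)
  have hyc : Continuous y := continuous_iff_continuousAt.2 fun t =>
    ((hsol (t + 1)).hasDerivAt t (by linarith)).continuousAt
  obtain ⟨M, hM⟩ : ∃ M, ∀ t ≤ τ, y t ≤ M := by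
    obtain ⟨s, hs⟩ := eventually_atBot.1 ((hsol 0).tendsto.eventually_lt_const one_lt_two)
    obtain ⟨B, hB⟩ := (isCompact_Icc (a := s) (b := τ)).bddAbove_image hyc.continuousOn
    refine ⟨max 2 B, fun t ht => ?_⟩
    rcases le_total t s with hts | hts
    · exact (hs t hts).le.trans (le_max_left _ _)
    · exact (hB (mem_image_of_mem _ ⟨hts, ht⟩)).trans (le_max_right _ _)
  set D := (A * exp (-(θ * τ))) ^ 2 * (M ^ 2 + ((exp τ + θ) * M) ^ 2) with hD
  have hint : IntegrableOn (fun r : ℝ => D * r ^ ((N : ℝ) - 3 - 2 * θ)) (Ioo 0 1) := by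
    refine Integrable.const_mul ?_ D
    exact (intervalIntegral.integrableOn_Ioo_rpow_iff one_pos).2
      (by linarith [h.a_pos, h.c_eq])
  refine Integrable.mono' hint ?_ ?_
  · refine ContinuousOn.aestronglyMeasurable (fun r hr => ?_) measurableSet_Ioo
    have h1 := (hfow.hasDerivAt_radial τ hr.1).continuousAt
    have h2 := (hfow.hasDerivAt_radial' τ hr.1).continuousAt
    exact (((h1.pow 2).add (h2.pow 2)).mul (continuousAt_id.pow _)).continuousWithinAt
  · refine (ae_restrict_iff' measurableSet_Ioo).2 (Eventually.of_forall fun r hr => ?_)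
    have ht : τ + log r ≤ τ := by linarith [log_nonpos hr.1.le hr.2.le]
    set t := τ + log r with ht_def
    have hy1 : y t ^ 2 ≤ M ^ 2 := pow_le_pow_left₀ (hpos t).le (hM t ht) 2
    have hv1 : (v t - θ * y t) ^ 2 ≤ ((exp τ + θ) * M) ^ 2 := by
      refine sq_le_sq' ?_ ?_
      all_goals
        have h1 := abs_le.1 (h.abs_deriv_le (hpos t) (hen t))
        have h2 := mul_le_mul (exp_le_exp.2 ht) (hM t ht) (hpos t).le (exp_pos τ).le
        have h3 := mul_le_mul_of_nonneg_left (hM t ht) h.θ_pos.le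
        have h4 := mul_pos h.θ_pos (hpos t)
        have h5 := mul_pos (exp_pos t) (hpos t)
        linarith [h1.1, h1.2]
    have hr2 : 1 ≤ r ^ (-2 : ℝ) := one_le_rpow_of_pos_of_le_one_of_nonpos hr.1 hr.2.le (by norm_num)
    have e1 : (r⁻¹) ^ 2 = r ^ (-2 : ℝ) := by
      rw [rpow_neg hr.1.le, inv_pow, rpow_two]
    have e2 : r ^ ((N : ℝ) - 3 - 2 * θ) = (r ^ (-θ)) ^ 2 * r ^ (-2 : ℝ) * r ^ (N - 1) := by
      rw [← rpow_natCast, ← rpow_mul hr.1.le, ← rpow_natCast r (N - 1), ← rpow_add hr.1,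
        ← rpow_add hr.1]
      congr 1
      push_cast [hN]
      ring
    have hrN : 0 ≤ r ^ (N - 1) := pow_nonneg hr.1.le _
    rw [Real.norm_eq_abs, abs_of_nonneg (mul_nonneg (by positivity) hrN), e2, exp_neg_mul_add_log θ τ hr.1]
    calc _ = (A * exp (-(θ * τ))) ^ 2 * (r ^ (-θ)) ^ 2 *
          (y t ^ 2 + (v t - θ * y t) ^ 2 * (r⁻¹) ^ 2) * r ^ (N - 1) := by ring
      _ ≤ (A * exp (-(θ * τ))) ^ 2 * (r ^ (-θ)) ^ 2 *
          (M ^ 2 * r ^ (-2 : ℝ) + ((exp τ + θ) * M) ^ 2 * r ^ (-2 : ℝ)) * r ^ (N - 1) := by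
        rw [e1]
        gcongr
        exact hy1.trans (le_mul_of_one_le_right (sq_nonneg M) hr2)
      _ = _ := by rw [hD]; ring

end FowlerParams

lemma fowlerParams {N : ℕ} (hN : 3 ≤ N) {p : ℝ} (hp : 1 < p) (hpS : pSob N < p) :
    FowlerParams ((N : ℝ) - 2 - 2 * thetaP p) ((N : ℝ) - 2)
      (thetaP p * ((N : ℝ) - 2 - thetaP p)) (thetaP p) (Aconst N p) p := by
  have hN' : (3 : ℝ) ≤ N := by exact_mod_cast hN
  have hp0 : 0 < p - 1 := by linarith
  have hθ : 0 < thetaP p := div_pos two_pos hp0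
  have hθp : thetaP p * (p - 1) = 2 := div_mul_cancel₀ _ hp0.ne'
  have ha : 0 < (N : ℝ) - 2 - 2 * thetaP p := by
    rw [pSob, div_lt_iff₀ (by linarith)] at hpS
    refine (mul_pos_iff_of_pos_right hp0).1 ?_
    linarith
  have hκ : 0 < thetaP p * ((N : ℝ) - 2 - thetaP p) := mul_pos hθ (by linarith)
  refine ⟨hp, ha, hθ, hκ, rpow_pos_of_pos hκ _, hθp, by ring, rfl, ?_⟩
  rw [Aconst, ← rpow_mul hκ.le, one_div_mul_cancel hp0.ne', rpow_one]

lemma singBVPSol_of_criticalPt {N : ℕ} {p : ℝ} {a κ : ℝ} {y : ℝ → ℝ}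
    (h : FowlerParams a ((N : ℝ) - 2) κ (thetaP p) (Aconst N p) p)
    (hlim : Tendsto y atBot (𝓝 1)) {V : ℝ → ℝ}
    (hfow : FowlerSol ((N : ℝ) - 2) p
      (fun t => Aconst N p * exp (-(thetaP p * t)) * y t) V) {τ : ℝ} (hτ : V τ = 0) {k : ℕ}
    (hk : {t | t ≤ τ ∧ Aconst N p * exp (-(thetaP p * t)) * y t = 1}.encard = (k : ℕ∞)) :
    SingBVPSol N p (exp (2 * τ)) k
      (fun r => Aconst N p * exp (-(thetaP p * (τ + log r))) * y (τ + log r))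
      (fun r => V (τ + log r) / r)
      (fun r => -(((N : ℝ) - 2 + 1) / r * (V (τ + log r) / r)) - exp (2 * τ) *
        fNL p (Aconst N p * exp (-(thetaP p * (τ + log r))) * y (τ + log r))) := by
  refine ⟨fun r hr => (hfow.hasDerivAt_radial τ hr.1).hasDerivWithinAt,
    fun r hr => hfow.hasDerivAt_radial' τ hr.1,
    fun r hr => (hfow.hasDerivAt_radial τ hr.1).continuousAt.continuousWithinAt,
    fun r hr => ?_, fun r hr => by ring, by simp [hτ], ?_, ?_, fun r hr => hfow.pos _⟩
  · have h1 := (hfow.hasDerivAt_radial τ hr.1).continuousAt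
    have h2 := (hfow.hasDerivAt_radial' τ hr.1).continuousAt
    refine ContinuousAt.continuousWithinAt (((continuousAt_const.div continuousAt_id
      hr.1.ne').mul h2).neg.sub (continuousAt_const.mul (h1.neg.add (h1.rpow_const ?_))))
    exact Or.inr (by linarith [h.one_lt])
  · rw [← exp_mul, show 2 * τ * (-thetaP p / 2) = -(thetaP p * τ) by ring]
    exact tendsto_rpow_mul_profile hlim _ _ τ
  · rw [← hk]
    exact FowlerSol.encard_radial (fun t => Aconst N p * exp (-(thetaP p * t)) * y t) τ

lemma eqOn_of_singBVPSol {N : ℕ} {p τ : ℝ} {k : ℕ} {a κ : ℝ} {y v : ℝ → ℝ}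
    (h : FowlerParams a ((N : ℝ) - 2) κ (thetaP p) (Aconst N p) p)
    (hsol : ∀ b, EFSol a κ p b y v) {U U' U'' : ℝ → ℝ}
    (hU : SingBVPSol N p (exp (2 * τ)) k U U' U'') :
    EqOn U (fun r => Aconst N p * exp (-(thetaP p * (τ + log r))) * y (τ + log r))
      (Ioc 0 1) := by
  obtain ⟨h1, h2, h3, -, h5, -, h7, -, h9⟩ := hU
  have hef := h.efSol_of_radial (τ := τ)
    (fun r hr => (h1 r (Ioo_subset_Ioc_self hr)).hasDerivAt (Ioc_mem_nhds hr.1 hr.2)) h2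
    (fun r hr => by
      have := h5 r hr
      rwa [show (N : ℝ) - 1 = (N : ℝ) - 2 + 1 by ring] at this)
    (fun r hr => h9 r (Ioo_subset_Ioc_self hr)) (by
      rwa [← exp_mul, show 2 * τ * (-thetaP p / 2) = -(thetaP p * τ) by ring] at h7)
  have huniq := hef.unique h.a_pos h.κ_pos h.one_lt (hsol τ)
  have hyc : Continuous y := continuous_iff_continuousAt.2 fun t =>
    ((hsol (t + 1)).hasDerivAt t (by linarith)).continuousAt
  refine EqOn.of_subset_closure (s := Ioo 0 1) (fun r hr => ?_) h3 (fun r hr => ?_)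
    Ioo_subset_Ioc_self (by rw [closure_Ioo zero_ne_one]; exact Ioc_subset_Icc_self)
  · have h4 := huniq (τ + log r) (by linarith [log_neg hr.1 hr.2])
    simp only [add_sub_cancel_left, exp_log hr.1] at h4
    have e : exp (-(thetaP p * (τ + log r))) * exp (thetaP p * (τ + log r)) = 1 := by
      rw [← exp_add]; simp
    rw [← h4]
    linear_combination (-U r) * e - (exp (-(thetaP p * (τ + log r))) *
      exp (thetaP p * (τ + log r)) * U r) * mul_inv_cancel₀ h.A_pos.ne'
  · have hl : ContinuousAt (fun r => τ + log r) r :=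
      continuousAt_const.add (continuousAt_log hr.1.ne')
    exact ((continuousAt_const.mul ((continuousAt_const.mul hl).neg.rexp)).mul
      (hyc.continuousAt.comp hl)).continuousWithinAt

/-- Theorem A: infinitely many singular solutions of the Neumann
problem, with asymptotics, prescribed intersection number with `1`, positivity,
`H¹`-integrability, and uniqueness. -/
theorem infinitely_many_singular_Neumann_solutions (N : ℕ) (hN : 3 ≤ N) (p : ℝ)
    (hp : 1 < p) (hpS : pSob N < p) :
    ∃ lam : ℕ → ℝ, StrictMono lam ∧ (∀ k, 0 < lam k) ∧ Tendsto lam atTop atTop ∧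
      ∀ k : ℕ, ∃ U U' U'' : ℝ → ℝ,
        SingBVPSol N p (lam k) (k + 1) U U' U'' ∧
        IntegrableOn (fun r => (U r ^ 2 + U' r ^ 2) * r ^ (N - 1)) (Ioo 0 1) ∧
        (∀ lam' : ℝ, ∀ V V' V'' : ℝ → ℝ, 0 < lam' →
          SingBVPSol N p lam' (k + 1) V V' V'' →
          lam' = lam k ∧ EqOn V U (Ioc 0 1)) := by
  have hpar := fowlerParams hN hp hpS
  have hN' : (3 : ℝ) ≤ N := by exact_mod_cast hN
  obtain ⟨y, v, hsol, hen⟩ := exists_efSol hpar.a_pos hpar.κ_pos hp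
  have hfow := hpar.fowlerSol hsol hen
  obtain ⟨τ, hmono, htend, hcrit, hcount, hall⟩ :=
    hfow.exists_criticalPt_seq (by linarith) hp
  have hsing := fun k => singBVPSol_of_criticalPt hpar (hsol 0).tendsto hfow (hcrit k)
    (k := k + 1) (by rw [hcount k]; push_cast; rfl)
  refine ⟨fun k => exp (2 * τ k), fun i j hij => exp_lt_exp.2 (by linarith [hmono hij]),
    fun k => exp_pos _, tendsto_exp_atTop.comp (htend.const_mul_atTop two_pos),
    fun k => ⟨_, _, _, hsing k,
      hpar.integrableOn_radial (by omega) rfl hsol hen (τ k), ?_⟩⟩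
  intro lam' V V' V'' hlam hV
  obtain ⟨σ, rfl⟩ : ∃ σ, lam' = exp (2 * σ) :=
    ⟨log lam' / 2, by rw [mul_div_cancel₀ _ two_ne_zero, exp_log hlam]⟩
  have heq := eqOn_of_singBVPSol hpar hsol hV
  have h1 : (1 : ℝ) ∈ Ioc (0 : ℝ) 1 := ⟨one_pos, le_rfl⟩
  have hder := ((hfow.hasDerivAt_radial σ one_pos).hasDerivWithinAt.congr heq (heq h1))
  have huniq := (uniqueDiffOn_Ioc (0 : ℝ) 1 1 h1).eq_deriv _ hder (hV.1 1 h1)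
  rw [hV.2.2.2.2.2.1, log_one, add_zero, div_one] at huniq
  obtain ⟨j, rfl⟩ := hall σ huniq
  have hset : {r ∈ Ioc (0 : ℝ) 1 | V r = 1} = {r ∈ Ioc (0 : ℝ) 1 |
      Aconst N p * exp (-(thetaP p * (τ j + log r))) * y (τ j + log r) = 1} := by
    ext r
    refine and_congr_right fun hr => ?_
    rw [heq hr]
  have hj := (hsing j).2.2.2.2.2.2.2.1
  rw [← hset, hV.2.2.2.2.2.2.2.1] at hj
  obtain rfl : k = j := by
    have : k + 1 = j + 1 := by exact_mod_cast hj
    omega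
  exact ⟨rfl, heq⟩
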